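/- Let n ≥ 1. Let f : ℝⁿ → ℝ be twice continuously differentiable with ν(x) = e^{-f(x)} a strictly positive probability density, and let ρ : ℝ × ℝⁿ → ℝ be such that ρ(t,·) is, for each t, a strictly positive probability density, twice continuously differentiable in x and continuously differentiable in t, satisfying the Fokker–Planck equation ∂ρ/∂t (t,x) = div( ρ(t,x) ∇f(x) + ∇_x ρ(t,x) ) for all (t,x). Fix t and assume: (i) the functions x ↦ ρ(t,x) log(ρ(t,x)/ν(x)) and x ↦ ρ(t,x) ‖∇_x log(ρ(t,x)/ν(x))‖² are integrable; (ii) the map H(t) = ∫ ρ(t,x) log(ρ(t,x)/ν(x)) dx is differentiable at t with H'(t) = ∫ ∂ρ/∂t (t,x) · log(ρ(t,x)/ν(x)) dx (differentiation under the integral sign, using ∫ ∂ρ/∂t dx = 0); and (iii) ∫ div( log(ρ(t,x)/ν(x)) · ( ρ(t,x)∇f(x) + ∇_x ρ(t,x) ) ) dx = 0. Then H'(t) = − ∫ ρ(t,x) ‖∇_x log(ρ(t,x)/ν(x))‖² dx. -/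

import Mathlib

open MeasureTheory Real

/-- Divergence of a vector field on `EuclideanSpace ℝ (Fin n)`:
`div V x = ∑ i, ∂V_i/∂x_i (x)`. -/
noncomputable def vdiv {n : ℕ} (V : EuclideanSpace ℝ (Fin n) → EuclideanSpace ℝ (Fin n))
    (x : EuclideanSpace ℝ (Fin n)) : ℝ :=
  ∑ i, fderiv ℝ (fun y => V y i) x (EuclideanSpace.single i 1)

section helpers

open MeasureTheory Real Set Filter Topology

/-- Weighted Laplacian: `div (e^{-f} ∇u)`. -/
noncomputable def wlap {n : ℕ} (f u : EuclideanSpace ℝ (Fin n) → ℝ)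
    (x : EuclideanSpace ℝ (Fin n)) : ℝ :=
  vdiv (fun y => exp (-f y) • gradient u y) x

section basics

variable {n : ℕ}

lemma contDiff_gradient {u : EuclideanSpace ℝ (Fin n) → ℝ} (hu : ContDiff ℝ 2 u) :
    ContDiff ℝ 1 (gradient u) := by
  unfold gradient
  have h : ContDiff ℝ 1 (fderiv ℝ u) := hu.fderiv_right (by norm_num)
  exact (InnerProductSpace.toDual ℝ (EuclideanSpace ℝ (Fin n))).symm.toContinuousLinearEquiv.contDiff.comp h

lemma continuous_gradient {u : EuclideanSpace ℝ (Fin n) → ℝ} (hu : ContDiff ℝ 1 u) :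
    Continuous (gradient u) := by
  unfold gradient
  have h : Continuous (fderiv ℝ u) := hu.continuous_fderiv (by norm_num)
  exact (InnerProductSpace.toDual ℝ (EuclideanSpace ℝ (Fin n))).symm.continuous.comp h

lemma coord_contDiff {V : EuclideanSpace ℝ (Fin n) → EuclideanSpace ℝ (Fin n)}
    (hV : ContDiff ℝ 1 V) (i : Fin n) : ContDiff ℝ 1 (fun y => V y i) :=
  (EuclideanSpace.proj (𝕜 := ℝ) i).contDiff.comp hV

lemma continuous_vdiv {V : EuclideanSpace ℝ (Fin n) → EuclideanSpace ℝ (Fin n)}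
    (hV : ContDiff ℝ 1 V) : Continuous (vdiv V) := by
  unfold vdiv
  refine continuous_finsetSum _ fun i _ => ?_
  exact ((coord_contDiff hV i).continuous_fderiv (by norm_num)).clm_apply continuous_const

lemma vdiv_add {V W : EuclideanSpace ℝ (Fin n) → EuclideanSpace ℝ (Fin n)}
    (hV : ContDiff ℝ 1 V) (hW : ContDiff ℝ 1 W) (x) :
    vdiv (fun y => V y + W y) x = vdiv V x + vdiv W x := by
  unfold vdiv
  rw [← Finset.sum_add_distrib]
  refine Finset.sum_congr rfl fun i _ => ?_
  have h := fderiv_add (((coord_contDiff hV i).differentiable (by norm_num)) x)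
    (((coord_contDiff hW i).differentiable (by norm_num)) x)
  have h2 : (fun y => (V y + W y) i) = (fun y => V y i) + (fun y => W y i) := by
    ext y; simp
  rw [h2, h]; rfl

lemma vdiv_smul {a : EuclideanSpace ℝ (Fin n) → ℝ}
    {V : EuclideanSpace ℝ (Fin n) → EuclideanSpace ℝ (Fin n)}
    (ha : ContDiff ℝ 1 a) (hV : ContDiff ℝ 1 V) (x) :
    vdiv (fun y => a y • V y) x = a x * vdiv V x + inner ℝ (gradient a x) (V x) := by
  unfold vdiv
  have hd : ∀ i : Fin n, fderiv ℝ (fun y => (a y • V y) i) x (EuclideanSpace.single i 1)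
      = a x * fderiv ℝ (fun y => V y i) x (EuclideanSpace.single i 1)
        + V x i * fderiv ℝ a x (EuclideanSpace.single i 1) := by
    intro i
    have h2 : (fun y => (a y • V y) i) = (fun y => a y * V y i) := by
      ext y; simp
    rw [h2, fderiv_fun_mul ((ha.differentiable (by norm_num)) x)
      (((coord_contDiff hV i).differentiable (by norm_num)) x)]
    simp
  simp_rw [hd]
  rw [Finset.sum_add_distrib, Finset.mul_sum, inner_gradient_left]
  congr 1
  have hx : V x = ∑ i, V x i • EuclideanSpace.single i (1:ℝ) := by
    ext j
    simp [Finset.sum_apply, Pi.single_apply]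
  conv_rhs => rw [hx]
  rw [map_sum]
  simp

/-- Integral of the divergence of a compactly supported field vanishes. -/
lemma integral_vdiv_zero {V : EuclideanSpace ℝ (Fin n) → EuclideanSpace ℝ (Fin n)}
    (hV : ContDiff ℝ 1 V) (hc : HasCompactSupport V) : ∫ x, vdiv V x = 0 := by
  unfold vdiv
  have hcc : ∀ i, HasCompactSupport (fun y => V y i) := fun i =>
    hc.comp_left (g := fun v : EuclideanSpace ℝ (Fin n) => v i) rfl
  have hint : ∀ i : Fin n, Integrable
      (fun x => fderiv ℝ (fun y => V y i) x (EuclideanSpace.single i (1:ℝ))) := by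
    intro i
    refine Continuous.integrable_of_hasCompactSupport
      (((coord_contDiff hV i).continuous_fderiv (by norm_num)).clm_apply continuous_const) ?_
    exact (hcc i).fderiv (𝕜 := ℝ) |>.comp_left (g := fun l : EuclideanSpace ℝ (Fin n) →L[ℝ] ℝ =>
      l (EuclideanSpace.single i (1:ℝ))) rfl
  rw [integral_finsetSum _ fun i _ => hint i]
  refine Finset.sum_eq_zero fun i _ => ?_
  have := integral_mul_fderiv_eq_neg_fderiv_mul_of_integrable (μ := (volume : Measure (EuclideanSpace ℝ (Fin n))))
    (f := fun _ => (1:ℝ)) (g := fun y => V y i) (v := EuclideanSpace.single i (1:ℝ))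
    (by simp) (by simpa using hint i)
    (by simpa using (coord_contDiff hV i).continuous.integrable_of_hasCompactSupport (hcc i))
    (fun x _ => by fun_prop)
    (fun x _ => ((coord_contDiff hV i).differentiable (by norm_num)) x)
  simpa using this

lemma ibp {ζ : EuclideanSpace ℝ (Fin n) → ℝ}
    {V : EuclideanSpace ℝ (Fin n) → EuclideanSpace ℝ (Fin n)}
    (hζ : ContDiff ℝ 1 ζ) (hV : ContDiff ℝ 1 V) (hc : HasCompactSupport ζ ∨ HasCompactSupport V) :
    ∫ x, ζ x * vdiv V x = -∫ x, inner ℝ (gradient ζ x) (V x) := by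
  have hcs : HasCompactSupport (fun y => ζ y • V y) := by
    rcases hc with h | h
    · exact h.smul_right (f' := V)
    · exact h.smul_left (f := ζ)
  have h0 := integral_vdiv_zero (hζ.smul hV) hcs
  have e : ∀ x, vdiv (fun y => ζ y • V y) x = ζ x * vdiv V x + inner ℝ (gradient ζ x) (V x) :=
    vdiv_smul hζ hV
  have hc1 : Continuous (fun x => ζ x * vdiv V x) := hζ.continuous.mul (continuous_vdiv hV)
  have hc2 : Continuous (fun x => inner ℝ (gradient ζ x) (V x)) :=
    (continuous_gradient hζ).inner hV.continuous
  have s2 : HasCompactSupport (fun x => inner ℝ (gradient ζ x) (V x)) := by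
    rcases hc with h | h
    · have : HasCompactSupport (gradient ζ) := by
        have := h.fderiv (𝕜 := ℝ)
        exact this.comp_left (g := (InnerProductSpace.toDual ℝ (EuclideanSpace ℝ (Fin n))).symm)
          (map_zero _)
      exact this.mono (fun x hx => by
        simp only [Function.mem_support] at hx ⊢
        intro h; apply hx; simp [h])
    · exact h.mono (fun x hx => by
        simp only [Function.mem_support] at hx ⊢
        intro h; apply hx; simp [h])
  have s1 : HasCompactSupport (fun x => ζ x * vdiv V x) := by
    rcases hc with h | h
    · exact h.mul_right
    · have : HasCompactSupport (vdiv V) := by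
        refine HasCompactSupport.intro h (fun x hx => ?_)
        unfold vdiv
        refine Finset.sum_eq_zero fun i _ => ?_
        have : (fun y => V y i) =ᶠ[𝓝 x] fun _ => 0 := by
          have := notMem_tsupport_iff_eventuallyEq.mp hx
          filter_upwards [this] with y hy
          simp [hy]
        rw [this.fderiv_eq]; simp
      exact this.mul_left
  have i1 := hc1.integrable_of_hasCompactSupport (μ := volume) s1
  have i2 := hc2.integrable_of_hasCompactSupport (μ := volume) s2
  replace h0 : ∫ x, (ζ x * vdiv V x + inner ℝ (gradient ζ x) (V x)) = 0 := by
    rw [← h0]; exact integral_congr_ae (ae_of_all _ fun x => (e x).symm)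
  rw [integral_add i1 i2] at h0
  linarith

lemma contDiff_expneg {f : EuclideanSpace ℝ (Fin n) → ℝ} (hf : ContDiff ℝ 2 f) :
    ContDiff ℝ 2 (fun x => exp (-f x)) := hf.neg.exp

lemma wfield {f u : EuclideanSpace ℝ (Fin n) → ℝ} (hf : ContDiff ℝ 2 f) (hu : ContDiff ℝ 2 u) :
    ContDiff ℝ 1 (fun y => exp (-f y) • gradient u y) :=
  ((contDiff_expneg hf).of_le (by norm_num)).smul (contDiff_gradient hu)

lemma continuous_wlap {f u : EuclideanSpace ℝ (Fin n) → ℝ} (hf : ContDiff ℝ 2 f)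
    (hu : ContDiff ℝ 2 u) : Continuous (wlap f u) := continuous_vdiv (wfield hf hu)

lemma gradient_compactSupport {u : EuclideanSpace ℝ (Fin n) → ℝ} (h : HasCompactSupport u) :
    HasCompactSupport (gradient u) :=
  (h.fderiv (𝕜 := ℝ)).comp_left (g := (InnerProductSpace.toDual ℝ (EuclideanSpace ℝ (Fin n))).symm)
          (map_zero _)

lemma wlap_ibp {f u ζ : EuclideanSpace ℝ (Fin n) → ℝ} (hf : ContDiff ℝ 2 f)
    (hu : ContDiff ℝ 2 u) (hζ : ContDiff ℝ 1 ζ) (hc : HasCompactSupport ζ ∨ HasCompactSupport u) :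
    ∫ x, ζ x * wlap f u x = -∫ x, exp (-f x) * inner ℝ (gradient ζ x) (gradient u x) := by
  have := ibp hζ (wfield hf hu) (hc.imp id fun h =>
    (gradient_compactSupport h).smul_left (f := fun y => exp (-f y)))
  simp only [inner_smul_right] at this
  exact this

lemma wlap_symm {f u ζ : EuclideanSpace ℝ (Fin n) → ℝ} (hf : ContDiff ℝ 2 f)
    (hu : ContDiff ℝ 2 u) (hζ : ContDiff ℝ 2 ζ) (hc : HasCompactSupport ζ) :
    ∫ x, ζ x * wlap f u x = ∫ x, u x * wlap f ζ x := by
  rw [wlap_ibp hf hu (hζ.of_le (by norm_num)) (Or.inl hc),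
    wlap_ibp hf hζ (hu.of_le (by norm_num)) (Or.inr hc)]
  simp_rw [real_inner_comm]

lemma gradient_sub' {u v : EuclideanSpace ℝ (Fin n) → ℝ} (hu : ContDiff ℝ 2 u)
    (hv : ContDiff ℝ 2 v) (x) : gradient (fun y => u y - v y) x = gradient u x - gradient v x := by
  unfold gradient
  rw [fderiv_fun_sub (hu.differentiable (by norm_num) x) (hv.differentiable (by norm_num) x), map_sub]

lemma wlap_sub {f u v : EuclideanSpace ℝ (Fin n) → ℝ} (hf : ContDiff ℝ 2 f)
    (hu : ContDiff ℝ 2 u) (hv : ContDiff ℝ 2 v) (x) :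
    wlap f (fun y => u y - v y) x = wlap f u x - wlap f v x := by
  have h := vdiv_add (wfield hf (hu.sub hv)) (wfield hf hv) x
  have : (fun y => exp (-f y) • gradient (fun y => u y - v y) y + exp (-f y) • gradient v y)
      = fun y => exp (-f y) • gradient u y := by
    ext1 y
    rw [gradient_sub' hu hv, ← smul_add, sub_add_cancel]
  rw [this] at h
  unfold wlap
  rw [h]; ring

lemma gradient_mul' {u v : EuclideanSpace ℝ (Fin n) → ℝ} {x}
    (hu : DifferentiableAt ℝ u x) (hv : DifferentiableAt ℝ v x) :
    gradient (fun y => u y * v y) x = u x • gradient v x + v x • gradient u x := by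
  unfold gradient
  rw [fderiv_fun_mul hu hv, map_add, LinearIsometryEquiv.map_smul, LinearIsometryEquiv.map_smul]

lemma gradient_comp' {u : EuclideanSpace ℝ (Fin n) → ℝ} {φ : ℝ → ℝ} {φ' : ℝ} {x}
    (hφ : HasDerivAt φ φ' (u x)) (hu : DifferentiableAt ℝ u x) :
    gradient (fun y => φ (u y)) x = φ' • gradient u x := by
  unfold gradient
  have := (hφ.comp_hasFDerivAt x hu.hasFDerivAt).fderiv
  have e : (fun y => φ (u y)) = φ ∘ u := rfl
  rw [e, this, LinearIsometryEquiv.map_smul]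

lemma wlap_compactSupport {f u : EuclideanSpace ℝ (Fin n) → ℝ} (h : HasCompactSupport u) :
    HasCompactSupport (wlap f u) := by
  have h' := (gradient_compactSupport h).smul_left (f := fun y => exp (-f y))
  refine HasCompactSupport.intro h' (fun x hx => ?_)
  unfold wlap vdiv
  refine Finset.sum_eq_zero fun i _ => ?_
  have : (fun y => (exp (-f y) • gradient u y) i) =ᶠ[𝓝 x] fun _ => 0 := by
    have := notMem_tsupport_iff_eventuallyEq.mp hx
    filter_upwards [this] with y hy
    have hy' : exp (-f y) • gradient u y = 0 := hy
    rw [hy']; rfl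
  rw [this.fderiv_eq]; simp

end basics

structure FPSol {n : ℕ} (f : EuclideanSpace ℝ (Fin n) → ℝ)
    (ρ : ℝ → EuclideanSpace ℝ (Fin n) → ℝ) : Prop where
  hf : ContDiff ℝ 2 f
  hν : ∫ x, exp (-f x) = 1
  pos : ∀ t x, 0 < ρ t x
  prob : ∀ t, ∫ x, ρ t x = 1
  cx : ∀ t, ContDiff ℝ 2 (ρ t)
  ct : ∀ x, ContDiff ℝ 1 (fun s => ρ s x)
  eqn : ∀ t x, deriv (fun s => ρ s x) t = wlap f (fun y => ρ t y * exp (f y)) x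

noncomputable def gg {n : ℕ} (f : EuclideanSpace ℝ (Fin n) → ℝ)
    (ρ : ℝ → EuclideanSpace ℝ (Fin n) → ℝ) (t : ℝ) (x : EuclideanSpace ℝ (Fin n)) : ℝ :=
  ρ t x * exp (f x)

noncomputable def mm {n : ℕ} (ρ : ℝ → EuclideanSpace ℝ (Fin n) → ℝ)
    (ζ : EuclideanSpace ℝ (Fin n) → ℝ) (s : ℝ) : ℝ := ∫ x, ρ s x * ζ x

noncomputable def qq {n : ℕ} (f : EuclideanSpace ℝ (Fin n) → ℝ)
    (ρ : ℝ → EuclideanSpace ℝ (Fin n) → ℝ)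
    (ζ : EuclideanSpace ℝ (Fin n) → ℝ) (s : ℝ) : ℝ := ∫ x, gg f ρ s x * wlap f ζ x

def GoodAt {n : ℕ} (f : EuclideanSpace ℝ (Fin n) → ℝ)
    (ρ : ℝ → EuclideanSpace ℝ (Fin n) → ℝ) (R s : ℝ) : Prop :=
  ∀ ζ : EuclideanSpace ℝ (Fin n) → ℝ, ContDiff ℝ 2 ζ → HasCompactSupport ζ →
    tsupport ζ ⊆ Metric.ball 0 R → HasDerivAt (mm ρ ζ) (qq f ρ ζ s) s

/-- Left-sided Dini comparison. -/
lemma dini_closed {Y : ℝ → ℝ} {C u v : ℝ} (huv : u ≤ v) (hY : ContinuousOn Y (Icc u v))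
    (h : ∀ τ ∈ Ioc u v, ∃ m : ℝ → ℝ, ∃ m' ≤ C, HasDerivAt m m' τ ∧
      ∀ τ' ∈ Ioo u τ, Y τ - Y τ' ≤ m τ - m τ') : Y v - Y u ≤ C * (v - u) := by
  have key := image_le_of_liminf_slope_right_le_deriv_boundary (f := fun s => -Y (-s))
    (a := -v) (b := -u) (B := fun s => -Y v + C * (s + v)) (B' := fun _ => C)
    (by
      refine (hY.comp continuous_neg.continuousOn ?_).neg
      intro s hs; exact ⟨by linarith [hs.2], by linarith [hs.1]⟩)
    (by simp) (by fun_prop)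
    (by
      intro x _
      have : HasDerivAt (fun s => -Y v + C * (s + v)) (C * 1) x :=
        (((hasDerivAt_id x).add_const v).const_mul C).const_add _
      simpa using this.hasDerivWithinAt)
    (by
      intro x hx r hr
      obtain ⟨m, m', hm', hd, hle⟩ := h (-x) ⟨by linarith [hx.2], by linarith [hx.1]⟩
      apply Eventually.frequently
      have hd2 : HasDerivAt (fun s => - m (-s)) m' x := by
        have := (hd.comp_of_eq x (hasDerivAt_neg x) rfl).neg
        have e : -(m' * -1) = m' := by ring
        rw [e] at this
        exact this
      have ht := (hasDerivAt_iff_tendsto_slope.mp hd2)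
      have ht' := ht.mono_left (nhdsWithin_mono x (show Ioi x ⊆ {x}ᶜ from fun y hy => ne_of_gt hy))
      have e1 := ht'.eventually (gt_mem_nhds (lt_of_le_of_lt hm' hr))
      filter_upwards [e1, Ioo_mem_nhdsGT hx.2] with z hz hz2
      refine lt_of_le_of_lt ?_ hz
      rw [slope_def_field, slope_def_field]
      have := hle (-z) ⟨by linarith [hz2.2], by linarith [hz2.1]⟩
      have hp : 0 < z - x := by linarith [hz2.1]
      apply div_le_div_of_nonneg_right _ hp.le
      linarith)
  have := key (x := -u) ⟨by linarith, le_refl _⟩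
  simp only [neg_neg] at this
  linarith

lemma dini {Y : ℝ → ℝ} {C u v : ℝ} (huv : u < v) (hY : ContinuousOn Y (Icc u v))
    (h : ∀ τ ∈ Ioo u v, ∃ m : ℝ → ℝ, ∃ m' ≤ C, HasDerivAt m m' τ ∧
      ∀ τ' ∈ Ioo u τ, Y τ - Y τ' ≤ m τ - m τ') : Y v - Y u ≤ C * (v - u) := by
  have h1 : ∀ w ∈ Ioo u v, Y w - Y u ≤ C * (w - u) := by
    intro w hw
    refine dini_closed hw.1.le (hY.mono (Icc_subset_Icc_right hw.2.le)) ?_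
    intro τ hτ
    exact h τ ⟨hτ.1, lt_of_le_of_lt hτ.2 hw.2⟩
  have hv : Tendsto Y (𝓝[<] v) (𝓝 (Y v)) := by
    have := (hY v ⟨huv.le, le_refl _⟩)
    exact this.mono_left (by
      rw [← nhdsWithin_Ioo_eq_nhdsLT huv]
      exact nhdsWithin_mono _ Ioo_subset_Icc_self)
  have h2 : Tendsto (fun w => C * (w - u)) (𝓝[<] v) (𝓝 (C * (v - u))) :=
    ((by fun_prop : Continuous fun w => C * (w - u)).tendsto v).mono_left nhdsWithin_le_nhds
  refine le_of_tendsto_of_tendsto (hv.sub_const _) h2 ?_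
  filter_upwards [Ioo_mem_nhdsLT huv] with w hw using h1 w hw

namespace FPSol

variable {n : ℕ} {f : EuclideanSpace ℝ (Fin n) → ℝ} {ρ : ℝ → EuclideanSpace ℝ (Fin n) → ℝ}

lemma int (S : FPSol f ρ) (t : ℝ) : Integrable (ρ t) :=
  integrable_of_integral_eq_one (S.prob t)

lemma intν (S : FPSol f ρ) : Integrable (fun x => exp (-f x)) :=
  integrable_of_integral_eq_one S.hν

lemma gcd (S : FPSol f ρ) (t : ℝ) : ContDiff ℝ 2 (gg f ρ t) := (S.cx t).mul S.hf.exp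

lemma gpos (S : FPSol f ρ) (t : ℝ) (x) : 0 < gg f ρ t x := mul_pos (S.pos t x) (exp_pos _)

lemma eg (_S : FPSol f ρ) (t : ℝ) (x) : exp (-f x) * gg f ρ t x = ρ t x := by
  unfold gg; rw [exp_neg]; field_simp

lemma eqn' (S : FPSol f ρ) (t : ℝ) (x) : deriv (fun s => ρ s x) t = wlap f (gg f ρ t) x :=
  S.eqn t x

lemma cont_t (S : FPSol f ρ) (x) : Continuous (fun s => ρ s x) := (S.ct x).continuous

lemma gcont_t (S : FPSol f ρ) (x) : Continuous (fun s => gg f ρ s x) :=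
  (S.cont_t x).mul continuous_const

lemma l1_le (S : FPSol f ρ) (s t : ℝ) : ∫ x, |ρ s x - ρ t x| ≤ 2 := by
  calc ∫ x, |ρ s x - ρ t x| ≤ ∫ x, (ρ s x + ρ t x) := by
        refine integral_mono ((S.int s).sub (S.int t)).abs ((S.int s).add (S.int t)) fun x => ?_
        have h1 := S.pos s x
        have h2 := S.pos t x
        rw [abs_le]; constructor <;> linarith
    _ = 2 := by rw [integral_add (S.int s) (S.int t), S.prob, S.prob]; norm_num

lemma l1 (S : FPSol f ρ) (t : ℝ) : Tendsto (fun s => ∫ x, |ρ s x - ρ t x|) (𝓝 t) (𝓝 0) := by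
  have hmin : ∀ s, Integrable (fun x => min (ρ s x) (ρ t x)) := fun s => (S.int s).inf (S.int t)
  have h1 : ∀ s, ∫ x, |ρ s x - ρ t x| = 2 - 2 * ∫ x, min (ρ s x) (ρ t x) := by
    intro s
    have : ∀ x, |ρ s x - ρ t x| = ρ s x + ρ t x - 2 * min (ρ s x) (ρ t x) := by
      intro x
      rcases le_total (ρ s x) (ρ t x) with h | h
      · rw [min_eq_left h, abs_of_nonpos (by linarith)]; ring
      · rw [min_eq_right h, abs_of_nonneg (by linarith)]; ring
    simp_rw [this]
    have hadd : Integrable (fun x => ρ s x + ρ t x) := (S.int s).add (S.int t)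
    rw [integral_sub hadd ((hmin s).const_mul 2),
      integral_add (S.int s) (S.int t), S.prob, S.prob, integral_const_mul]
    norm_num
  have h2 : Tendsto (fun s => ∫ x, min (ρ s x) (ρ t x)) (𝓝 t) (𝓝 (∫ x, min (ρ t x) (ρ t x))) := by
    refine tendsto_integral_filter_of_dominated_convergence (ρ t)
      (Eventually.of_forall fun s => (hmin s).aestronglyMeasurable) ?_ (S.int t) ?_
    · refine Eventually.of_forall fun s => ae_of_all _ fun x => ?_
      rw [norm_eq_abs, abs_of_nonneg (le_min (S.pos s x).le (S.pos t x).le)]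
      exact min_le_right _ _
    · exact ae_of_all _ fun x => ((S.cont_t x).min continuous_const).tendsto t
  simp only [min_self, S.prob] at h2
  have := (h2.const_mul 2).const_sub 2
  simp_rw [h1]
  simpa using this

lemma int_mul (S : FPSol f ρ) {b : EuclideanSpace ℝ (Fin n) → ℝ} {M : ℝ} (hb : Continuous b)
    (hM : ∀ x, |b x| ≤ M) (s : ℝ) : Integrable (fun x => ρ s x * b x) :=
  (S.int s).mul_bdd hb.aestronglyMeasurable (ae_of_all _ hM)

lemma cont_pair (S : FPSol f ρ) {b : EuclideanSpace ℝ (Fin n) → ℝ} {M : ℝ} (hb : Continuous b)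
    (hM : ∀ x, |b x| ≤ M) : Continuous (fun s => ∫ x, ρ s x * b x) := by
  rw [continuous_iff_continuousAt]
  intro t
  rw [ContinuousAt, tendsto_iff_norm_sub_tendsto_zero]
  refine squeeze_zero (fun _ => norm_nonneg _) (fun s => ?_)
    (by simpa using (S.l1 t).const_mul M)
  rw [← integral_sub (S.int_mul hb hM s) (S.int_mul hb hM t), ← integral_const_mul]
  refine (norm_integral_le_integral_norm _).trans ?_
  refine integral_mono_of_nonneg (ae_of_all _ fun _ => norm_nonneg _)
    (((S.int s).sub (S.int t)).abs.const_mul M) (ae_of_all _ fun x => ?_)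
  simp only [norm_eq_abs]
  rw [← sub_mul, abs_mul, mul_comm]
  gcongr
  exact hM x

lemma bdd_cs {b : EuclideanSpace ℝ (Fin n) → ℝ} (hb : Continuous b) (hc : HasCompactSupport b) :
    ∃ M, ∀ x, |b x| ≤ M := by
  obtain ⟨M, hM⟩ := hc.exists_bound_of_continuous hb
  exact ⟨M, hM⟩

lemma qq_eq (_S : FPSol f ρ) (ζ : EuclideanSpace ℝ (Fin n) → ℝ) (s : ℝ) :
    qq f ρ ζ s = ∫ x, ρ s x * (exp (f x) * wlap f ζ x) := by
  unfold qq gg; simp_rw [mul_assoc]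

lemma qq_cont (S : FPSol f ρ) {ζ : EuclideanSpace ℝ (Fin n) → ℝ} (h : ContDiff ℝ 2 ζ)
    (hc : HasCompactSupport ζ) : Continuous (qq f ρ ζ) := by
  have hb : Continuous (fun x => exp (f x) * wlap f ζ x) :=
    S.hf.continuous.rexp.mul (continuous_wlap S.hf h)
  obtain ⟨M, hM⟩ := bdd_cs hb (wlap_compactSupport hc).mul_left
  have := S.cont_pair hb hM
  exact this.congr fun s => (S.qq_eq ζ s).symm

lemma mm_cont (S : FPSol f ρ) {ζ : EuclideanSpace ℝ (Fin n) → ℝ} (h : Continuous ζ)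
    (hc : HasCompactSupport ζ) : Continuous (mm ρ ζ) := by
  obtain ⟨M, hM⟩ := bdd_cs h hc
  exact S.cont_pair h hM

lemma qq_symm (S : FPSol f ρ) {ζ : EuclideanSpace ℝ (Fin n) → ℝ} (h : ContDiff ℝ 2 ζ)
    (hc : HasCompactSupport ζ) (s : ℝ) : qq f ρ ζ s = ∫ x, ζ x * wlap f (gg f ρ s) x :=
  (wlap_symm S.hf (S.gcd s) h hc).symm

end FPSol

section kato

variable {n : ℕ} {f : EuclideanSpace ℝ (Fin n) → ℝ} {ρ : ℝ → EuclideanSpace ℝ (Fin n) → ℝ}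

lemma comp_ibp {χ w : EuclideanSpace ℝ (Fin n) → ℝ} {ψ ψ' : ℝ → ℝ} (hf : ContDiff ℝ 2 f)
    (hχ : ContDiff ℝ 2 χ) (hc : HasCompactSupport χ) (hw : ContDiff ℝ 2 w)
    (hψ : ∀ x, HasDerivAt ψ (ψ' (w x)) (w x)) (hψw : ContDiff ℝ 2 (fun x => ψ (w x))) :
    ∫ x, (χ x * ψ (w x)) * wlap f w x = -∫ x, exp (-f x) *
      (χ x * (ψ' (w x) * ‖gradient w x‖ ^ 2) + ψ (w x) * inner ℝ (gradient χ x) (gradient w x)) := by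
  rw [wlap_ibp hf hw ((hχ.mul hψw).of_le (by norm_num)) (Or.inl hc.mul_right)]
  congr 1
  refine integral_congr_ae (ae_of_all _ fun x => ?_)
  simp only
  rw [gradient_mul' (hχ.differentiable (by norm_num) x) (hψw.differentiable (by norm_num) x),
    gradient_comp' (hψ x) (hw.differentiable (by norm_num) x), inner_add_left, inner_smul_left,
    inner_smul_left, inner_smul_left, real_inner_self_eq_norm_sq]
  simp

noncomputable def jj (ε s : ℝ) : ℝ := √(ε ^ 2 + s ^ 2) - ε
noncomputable def jd (ε s : ℝ) : ℝ := s / √(ε ^ 2 + s ^ 2)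
noncomputable def jdd (ε s : ℝ) : ℝ := ε ^ 2 / ((ε ^ 2 + s ^ 2) * √(ε ^ 2 + s ^ 2))

lemma jpos {ε : ℝ} (hε : 0 < ε) (s : ℝ) : 0 < ε ^ 2 + s ^ 2 := by positivity

lemma jj_deriv {ε : ℝ} (hε : 0 < ε) (s : ℝ) : HasDerivAt (jj ε) (jd ε s) s := by
  have h := jpos hε s
  have h1 : HasDerivAt (fun s : ℝ => ε ^ 2 + s ^ 2) (2 * s) s := by
    simpa using (hasDerivAt_pow 2 s).const_add (ε ^ 2)
  have := (h1.sqrt h.ne').sub_const ε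
  refine this.congr_deriv ?_
  unfold jd
  have := (Real.sqrt_pos.mpr h).ne'
  field_simp

lemma jd_deriv {ε : ℝ} (hε : 0 < ε) (s : ℝ) : HasDerivAt (jd ε) (jdd ε s) s := by
  have h := jpos hε s
  have h1 : HasDerivAt (fun s : ℝ => ε ^ 2 + s ^ 2) (2 * s) s := by
    simpa using (hasDerivAt_pow 2 s).const_add (ε ^ 2)
  have h0 := (Real.sqrt_pos.mpr h).ne'
  have := (hasDerivAt_id s).div (h1.sqrt h.ne') h0
  refine this.congr_deriv ?_
  unfold jdd
  have e : √(ε ^ 2 + s ^ 2) ^ 2 = ε ^ 2 + s ^ 2 := Real.sq_sqrt h.le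
  have e2 := h.ne'
  simp only [id]
  rw [e]
  field_simp
  rw [e]; ring

lemma jd_contDiff {ε : ℝ} (hε : 0 < ε) : ContDiff ℝ 2 (jd ε) := by
  unfold jd
  refine contDiff_id.div (ContDiff.sqrt (by fun_prop) fun s => (jpos hε s).ne')
    fun s => (Real.sqrt_pos.mpr (jpos hε s)).ne'

lemma jj_contDiff {ε : ℝ} (hε : 0 < ε) : ContDiff ℝ 2 (jj ε) := by
  unfold jj
  exact (ContDiff.sqrt (by fun_prop) fun s => (jpos hε s).ne').sub contDiff_const

lemma jdd_nonneg {ε : ℝ} (s : ℝ) : 0 ≤ jdd ε s := by unfold jdd; positivity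

lemma jd_abs {ε : ℝ} (hε : 0 < ε) (s : ℝ) : |jd ε s| ≤ 1 := by
  unfold jd
  rw [abs_div, abs_of_pos (Real.sqrt_pos.mpr (jpos hε s)), div_le_one (Real.sqrt_pos.mpr (jpos hε s))]
  apply Real.abs_le_sqrt; nlinarith

lemma jj_lower {ε : ℝ} (s : ℝ) : |s| ≤ jj ε s + ε := by
  unfold jj
  have : |s| ≤ √(ε ^ 2 + s ^ 2) := Real.abs_le_sqrt (by nlinarith)
  linarith

lemma jj_upper {ε : ℝ} (hε : 0 < ε) (s : ℝ) : |jj ε s| ≤ |s| := by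
  unfold jj
  have h1 : ε ≤ √(ε ^ 2 + s ^ 2) := Real.le_sqrt_of_sq_le (by nlinarith)
  rw [abs_of_nonneg (by linarith)]
  have : √(ε ^ 2 + s ^ 2) ≤ ε + |s| := by
    rw [Real.sqrt_le_left (by positivity)]
    nlinarith [abs_nonneg s, sq_abs s, mul_nonneg hε.le (abs_nonneg s)]
  linarith

lemma jj_convex {ε : ℝ} (hε : 0 < ε) (a b : ℝ) : jj ε a - jj ε b ≤ jd ε a * (a - b) := by
  unfold jj jd
  have ha := Real.sqrt_pos.mpr (jpos hε a)
  have hb := Real.sqrt_pos.mpr (jpos hε b)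
  have ea : √(ε ^ 2 + a ^ 2) ^ 2 = ε ^ 2 + a ^ 2 := Real.sq_sqrt (jpos hε a).le
  have eb : √(ε ^ 2 + b ^ 2) ^ 2 = ε ^ 2 + b ^ 2 := Real.sq_sqrt (jpos hε b).le
  set A := √(ε ^ 2 + a ^ 2)
  set B := √(ε ^ 2 + b ^ 2)
  rw [div_mul_eq_mul_div, le_div_iff₀ ha]
  have key : ε ^ 2 + a * b ≤ A * B := by
    apply le_of_sq_le_sq _ (by positivity)
    rw [mul_pow, ea, eb]; nlinarith [sq_nonneg (ε * (a - b))]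
  nlinarith

lemma jj_lip {ε : ℝ} (hε : 0 < ε) (a b : ℝ) : |jj ε a - jj ε b| ≤ |a - b| := by
  have h1 := jj_convex hε a b
  have h2 := jj_convex hε b a
  have k : ∀ c d : ℝ, jd ε c * d ≤ |d| := fun c d => by
    calc jd ε c * d ≤ |jd ε c * d| := le_abs_self _
      _ = |jd ε c| * |d| := abs_mul _ _
      _ ≤ 1 * |d| := by gcongr; exact jd_abs hε c
      _ = |d| := one_mul _
  have h3 := k a (a - b)
  have h4 := k b (b - a)
  rw [abs_sub_comm b a] at h4
  rw [abs_le]; constructor <;> linarith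

/-- Kato-type inequality for the spatial operator. -/
lemma kato_space {χ w : EuclideanSpace ℝ (Fin n) → ℝ} (hf : ContDiff ℝ 2 f)
    (hχ : ContDiff ℝ 2 χ) (hc : HasCompactSupport χ) (h0 : ∀ x, 0 ≤ χ x) (hw : ContDiff ℝ 2 w)
    {ε : ℝ} (hε : 0 < ε) :
    ∫ x, (χ x * jd ε (w x)) * wlap f w x ≤ ∫ x, jj ε (w x) * wlap f χ x := by
  have hjw : ContDiff ℝ 2 (fun x => jj ε (w x)) := (jj_contDiff hε).comp hw
  have hjdw : ContDiff ℝ 2 (fun x => jd ε (w x)) := (jd_contDiff hε).comp hw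
  rw [comp_ibp hf hχ hc hw (fun x => jd_deriv hε (w x)) hjdw,
    wlap_ibp hf hχ (hjw.of_le (by norm_num)) (Or.inr hc)]
  rw [neg_le_neg_iff]
  have cg : Continuous (gradient w) := continuous_gradient (hw.of_le (by norm_num))
  have cχ : Continuous (gradient χ) := continuous_gradient (hχ.of_le (by norm_num))
  have ce : Continuous (fun x => exp (-f x)) := (contDiff_expneg hf).continuous
  have gcs := gradient_compactSupport hc
  have cjdd : Continuous (jdd ε) := by
    unfold jdd
    refine continuous_const.div (by fun_prop) fun s => ?_
    exact mul_ne_zero (jpos hε s).ne' (Real.sqrt_pos.mpr (jpos hε s)).ne'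
  have i1 : Integrable (fun x => exp (-f x) * inner ℝ (gradient (fun x => jj ε (w x)) x) (gradient χ x)) := by
    refine Continuous.integrable_of_hasCompactSupport
      (ce.mul ((continuous_gradient (hjw.of_le (by norm_num))).inner cχ)) ?_
    refine gcs.mono fun x hx => ?_
    simp only [Function.mem_support] at hx ⊢
    intro h; apply hx; simp [h]
  have i2 : Integrable (fun x => exp (-f x) *
      (χ x * (jdd ε (w x) * ‖gradient w x‖ ^ 2) + jd ε (w x) * inner ℝ (gradient χ x) (gradient w x))) := by
    refine Continuous.integrable_of_hasCompactSupport
      (ce.mul ((hχ.continuous.mul ((cjdd.comp hw.continuous).mul (cg.norm.pow 2))).add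
        (hjdw.continuous.mul (cχ.inner cg)))) ?_
    refine HasCompactSupport.intro hc fun x hx => ?_
    have h1 : χ x = 0 := image_eq_zero_of_notMem_tsupport hx
    have h2 : gradient χ x = 0 := by
      have := notMem_tsupport_iff_eventuallyEq.mp hx
      rw [this.gradient_eq]; exact gradient_const _ _
    simp [h1, h2]
  refine integral_mono i1 i2 fun x => ?_
  simp only
  rw [gradient_comp' (jj_deriv hε (w x)) (hw.differentiable (by norm_num) x), inner_smul_left,
    real_inner_comm]
  simp only [conj_trivial]
  have := mul_nonneg (h0 x) (mul_nonneg (jdd_nonneg (ε := ε) (w x)) (sq_nonneg ‖gradient w x‖))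
  gcongr
  linarith

lemma FPSol.kato (S : FPSol f ρ) {R u v N M : ℝ} (huv : u < v)
    (hgood : ∀ τ ∈ Ioo u v, GoodAt f ρ R τ)
    (hN : ∀ x ∈ Metric.ball 0 R, |deriv (fun s => ρ s x) u| ≤ N)
    {χ : EuclideanSpace ℝ (Fin n) → ℝ}
    (hχ : ContDiff ℝ 2 χ) (hc : HasCompactSupport χ) (hsupp : tsupport χ ⊆ Metric.ball 0 R)
    (h0 : ∀ x, 0 ≤ χ x) (hM : ∀ x, |exp (f x) * wlap f χ x| ≤ M) :
    ∫ x, χ x * |ρ v x - ρ u x| ≤ (M * 2 + N * ∫ x, χ x) * (v - u) := by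
  have ce : Continuous (fun x => exp (-f x)) := (contDiff_expneg S.hf).continuous
  obtain ⟨X, hX⟩ := FPSol.bdd_cs hχ.continuous hc
  have hX0 : 0 ≤ X := (abs_nonneg _).trans (hX 0)
  have hM0 : 0 ≤ M := (abs_nonneg _).trans (hM 0)
  have hεs : ∀ ε > 0, ∫ x, χ x * |ρ v x - ρ u x| ≤
      (M * 2 + N * ∫ x, χ x) * (v - u) + ε * ∫ x, χ x * exp (-f x) := by
    intro ε hε
    set w : ℝ → EuclideanSpace ℝ (Fin n) → ℝ := fun τ x => gg f ρ τ x - gg f ρ u x with hwdef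
    have hw : ∀ τ, ContDiff ℝ 2 (w τ) := fun τ => (S.gcd τ).sub (S.gcd u)
    have hwρ : ∀ τ x, exp (-f x) * |w τ x| = |ρ τ x - ρ u x| := by
      intro τ x
      rw [← abs_of_pos (exp_pos (-f x)), ← abs_mul, hwdef]
      simp only
      rw [mul_sub, S.eg, S.eg]
    set Y : ℝ → ℝ := fun τ => ∫ x, χ x * exp (-f x) * jj ε (w τ x) with hY
    have hjc : ∀ τ, Continuous (fun x => jj ε (w τ x)) := fun τ =>
      (jj_contDiff hε).continuous.comp (hw τ).continuous
    have hYi : ∀ τ, Integrable (fun x => χ x * exp (-f x) * jj ε (w τ x)) := fun τ =>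
      ((hχ.continuous.mul ce).mul (hjc τ)).integrable_of_hasCompactSupport
        (hc.mul_right.mul_right)
    have hYc : Continuous Y := by
      rw [continuous_iff_continuousAt]
      intro t
      rw [ContinuousAt, tendsto_iff_norm_sub_tendsto_zero]
      refine squeeze_zero (fun _ => norm_nonneg _) (fun s => ?_)
        (by simpa using (S.l1 t).const_mul X)
      rw [← integral_sub (hYi s) (hYi t), ← integral_const_mul]
      refine (norm_integral_le_integral_norm _).trans ?_
      refine integral_mono_of_nonneg (ae_of_all _ fun _ => norm_nonneg _)
        (((S.int s).sub (S.int t)).abs.const_mul X) (ae_of_all _ fun x => ?_)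
      simp only [norm_eq_abs]
      rw [← mul_sub, abs_mul, abs_mul, abs_of_pos (exp_pos (-f x)), mul_assoc]
      have h1 : exp (-f x) * |jj ε (w s x) - jj ε (w t x)| ≤ |ρ s x - ρ t x| := by
        calc exp (-f x) * |jj ε (w s x) - jj ε (w t x)| ≤ exp (-f x) * |w s x - w t x| := by
              exact mul_le_mul_of_nonneg_left (jj_lip hε _ _) (exp_pos _).le
          _ = |ρ s x - ρ t x| := by
              rw [← S.eg s x, ← S.eg t x, ← mul_sub, abs_mul, abs_of_pos (exp_pos (-f x)), hwdef]
              simp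
      exact mul_le_mul (hX x) h1 (by positivity) hX0
    have hd := dini (Y := Y) (C := M * 2 + N * ∫ x, χ x) huv hYc.continuousOn (by
      intro τ hτ
      set ζ : EuclideanSpace ℝ (Fin n) → ℝ := fun x => χ x * jd ε (w τ x) with hζ
      have hζd : ContDiff ℝ 2 ζ := hχ.mul ((jd_contDiff hε).comp (hw τ))
      have hζc : HasCompactSupport ζ := hc.mul_right
      have hζs : tsupport ζ ⊆ Metric.ball 0 R := (tsupport_mul_subset_left).trans hsupp
      refine ⟨mm ρ ζ, qq f ρ ζ τ, ?_, hgood τ hτ ζ hζd hζc hζs, ?_⟩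
      · rw [S.qq_symm hζd hζc]
        have e : ∀ x, ζ x * wlap f (gg f ρ τ) x
            = ζ x * wlap f (w τ) x + ζ x * wlap f (gg f ρ u) x := by
          intro x
          rw [hwdef]; simp only
          rw [wlap_sub S.hf (S.gcd τ) (S.gcd u)]; ring
        simp_rw [e]
        have cζ := hζd.continuous
        have i1 : Integrable (fun x => ζ x * wlap f (w τ) x) :=
          ((cζ.mul (continuous_wlap S.hf (hw τ))).integrable_of_hasCompactSupport hζc.mul_right)
        have i2 : Integrable (fun x => ζ x * wlap f (gg f ρ u) x) :=
          ((cζ.mul (continuous_wlap S.hf (S.gcd u))).integrable_of_hasCompactSupport hζc.mul_right)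
        rw [integral_add i1 i2]
        refine add_le_add ?_ ?_
        · refine (kato_space S.hf hχ hc h0 (hw τ) hε).trans ?_
          calc ∫ x, jj ε (w τ x) * wlap f χ x ≤ ∫ x, M * |ρ τ x - ρ u x| := by
                refine integral_mono (((hjc τ).mul
                  (continuous_wlap S.hf hχ)).integrable_of_hasCompactSupport
                  (wlap_compactSupport hc).mul_left)
                  (((S.int τ).sub (S.int u)).abs.const_mul M) fun x => ?_
                simp only
                rw [← hwρ]
                calc jj ε (w τ x) * wlap f χ x ≤ |jj ε (w τ x) * wlap f χ x| := le_abs_self _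
                  _ = |jj ε (w τ x)| * |wlap f χ x| := abs_mul _ _
                  _ ≤ |w τ x| * |wlap f χ x| := 
                    mul_le_mul_of_nonneg_right (jj_upper hε _) (abs_nonneg _)
                  _ = |exp (f x) * wlap f χ x| * (exp (-f x) * |w τ x|) := by
                    rw [abs_mul, abs_of_pos (exp_pos (f x)), exp_neg]
                    field_simp
                  _ ≤ M * (exp (-f x) * |w τ x|) := by gcongr; exact hM x
            _ ≤ M * 2 := by
                rw [integral_const_mul]; gcongr; exact S.l1_le _ _
        · rw [← integral_const_mul]
          refine integral_mono ((cζ.mul (continuous_wlap S.hf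
            (S.gcd u))).integrable_of_hasCompactSupport hζc.mul_right)
            ((hχ.continuous.integrable_of_hasCompactSupport hc).const_mul N) fun x => ?_
          simp only
          by_cases hx : x ∈ tsupport χ
          · have := hN x (hsupp hx)
            rw [S.eqn'] at this
            calc ζ x * wlap f (gg f ρ u) x ≤ |ζ x * wlap f (gg f ρ u) x| := le_abs_self _
              _ = χ x * |jd ε (w τ x)| * |wlap f (gg f ρ u) x| := by
                rw [abs_mul, hζ, abs_mul, abs_of_nonneg (h0 x)]
              _ ≤ χ x * 1 * N := by
                gcongr
                · have := h0 x; positivity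
                · exact h0 x
                · exact jd_abs hε _
              _ = N * χ x := by ring
          · have h1 : χ x = 0 := image_eq_zero_of_notMem_tsupport hx
            simp [hζ, h1]
      · intro τ' hτ'
        obtain ⟨Z, hZ⟩ := FPSol.bdd_cs hζd.continuous hζc
        unfold mm
        rw [← integral_sub (S.int_mul hζd.continuous hZ τ) (S.int_mul hζd.continuous hZ τ'), hY]
        simp only
        rw [← integral_sub (hYi τ) (hYi τ')]
        refine integral_mono ((hYi τ).sub (hYi τ'))
          ((S.int_mul hζd.continuous hZ τ).sub (S.int_mul hζd.continuous hZ τ')) fun x => ?_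
        simp only
        rw [← S.eg τ x, ← S.eg τ' x, hζ]
        have hj := jj_convex hε (w τ x) (w τ' x)
        have hww : w τ x - w τ' x = gg f ρ τ x - gg f ρ τ' x := by rw [hwdef]; simp
        rw [hww] at hj
        have := mul_le_mul_of_nonneg_left hj (mul_nonneg (h0 x) (exp_pos (-f x)).le)
        simp only
        linarith)
    have hY0 : Y u = 0 := by
      rw [hY]; simp [hwdef, jj, Real.sqrt_sq hε.le]
    have hfin : ∫ x, χ x * |ρ v x - ρ u x| ≤ Y v + ε * ∫ x, χ x * exp (-f x) := by
      rw [← integral_const_mul, hY]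
      simp only
      have ie : Integrable (fun x => ε * (χ x * exp (-f x))) :=
        ((hχ.continuous.mul ce).integrable_of_hasCompactSupport hc.mul_right).const_mul ε
      rw [← integral_add (hYi v) ie]
      refine integral_mono (Continuous.integrable_of_hasCompactSupport
        (hχ.continuous.mul (((S.cx v).continuous.sub (S.cx u).continuous).abs)) hc.mul_right)
        ((hYi v).add ie) fun x => ?_
      simp only
      rw [← hwρ]
      have := mul_le_mul_of_nonneg_left (jj_lower (ε := ε) (w v x))
        (mul_nonneg (h0 x) (exp_pos (-f x)).le)
      linarith
    linarith
  have hlim : Tendsto (fun ε : ℝ => (M * 2 + N * ∫ x, χ x) * (v - u) + ε * ∫ x, χ x * exp (-f x))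
      (𝓝[>] 0) (𝓝 ((M * 2 + N * ∫ x, χ x) * (v - u) + 0 * ∫ x, χ x * exp (-f x))) :=
    ((by fun_prop : Continuous fun ε : ℝ => (M * 2 + N * ∫ x, χ x) * (v - u)
      + ε * ∫ x, χ x * exp (-f x)).tendsto 0).mono_left nhdsWithin_le_nhds
  have := ge_of_tendsto hlim (by
    filter_upwards [self_mem_nhdsWithin] with ε hε using hεs ε hε)
  simpa using this

end kato

def gaps (K : Set ℝ) : Set (ℝ × ℝ) :=
  {p | p.1 ∈ K ∧ p.2 ∈ K ∧ p.1 < p.2 ∧ ∀ r ∈ Ioo p.1 p.2, r ∉ K}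

lemma gaps_disj (K : Set ℝ) : (gaps K).PairwiseDisjoint (fun p => Ioo p.1 p.2) := by
  intro p hp q hq hne
  simp only [Function.onFun]
  rw [Set.disjoint_left]
  intro r hr hr'
  apply hne
  obtain ⟨p1, p2, -, p4⟩ := hp
  obtain ⟨q1, q2, -, q4⟩ := hq
  apply Prod.ext
  · rcases lt_trichotomy p.1 q.1 with h | h | h
    · exact absurd q1 (p4 _ ⟨h, hr'.1.trans hr.2⟩)
    · exact h
    · exact absurd p1 (q4 _ ⟨h, hr.1.trans hr'.2⟩)
  · rcases lt_trichotomy p.2 q.2 with h | h | h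
    · exact absurd p2 (q4 _ ⟨hr'.1.trans hr.2, h⟩)
    · exact h
    · exact absurd q2 (p4 _ ⟨hr.1.trans hr'.2, h⟩)

lemma gaps_countable (K : Set ℝ) : (gaps K).Countable :=
  (gaps_disj K).countable_of_isOpen (fun _ _ => isOpen_Ioo) fun p hp => by
    rw [nonempty_Ioo]; exact hp.2.2.1

lemma gaps_iUnion {K : Set ℝ} (hK : IsClosed K) {s t : ℝ} (hs : s ∈ K) (ht : t ∈ K)
    (hsub : K ⊆ Icc s t) : (⋃ p : gaps K, Ioo p.1.1 p.1.2) = Icc s t \ K := by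
  ext r
  simp only [mem_iUnion, Set.mem_sdiff]
  constructor
  · rintro ⟨⟨p, hp⟩, hr⟩
    exact ⟨⟨(hsub hp.1).1.trans hr.1.le, hr.2.le.trans (hsub hp.2.1).2⟩, hp.2.2.2 r hr⟩
  · rintro ⟨hr, hrK⟩
    have hKc : IsCompact K := isCompact_Icc.of_isClosed_subset hK hsub
    have c1 : IsCompact (K ∩ Iic r) := hKc.inter_right isClosed_Iic
    have c2 : IsCompact (K ∩ Ici r) := hKc.inter_right isClosed_Ici
    obtain ⟨u, hu⟩ := c1.exists_isGreatest ⟨s, hs, hr.1⟩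
    obtain ⟨v, hv⟩ := c2.exists_isLeast ⟨t, ht, hr.2⟩
    have hur : u < r := lt_of_le_of_ne hu.1.2 fun h => hrK (h ▸ hu.1.1)
    have hrv : r < v := lt_of_le_of_ne hv.1.2 fun h => hrK (h ▸ hv.1.1)
    refine ⟨⟨(u, v), hu.1.1, hv.1.1, hur.trans hrv, ?_⟩, hur, hrv⟩
    intro z hz hzK
    rcases le_total z r with h | h
    · exact absurd (hu.2 ⟨hzK, h⟩) (not_le.mpr hz.1)
    · exact absurd (hv.2 ⟨hzK, h⟩) (not_le.mpr hz.2)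

lemma gaps_hasSum {K : Set ℝ} (hK : IsClosed K) {s t : ℝ} (hs : s ∈ K) (ht : t ∈ K)
    (hsub : K ⊆ Icc s t) {h : ℝ → ℝ} (hh : Continuous h) :
    HasSum (fun p : gaps K => ∫ r in p.1.1..p.1.2, h r)
      ((∫ r in s..t, h r) - ∫ r in K, h r) := by
  have hst : s ≤ t := (hsub hs).2
  have : Countable (gaps K) := (gaps_countable K).to_subtype
  have hi : IntegrableOn h (Icc s t) := hh.continuousOn.integrableOn_Icc
  have h1 := hasSum_integral_iUnion (μ := volume) (f := h)
    (s := fun p : gaps K => Ioo p.1.1 p.1.2)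
    (fun _ => measurableSet_Ioo)
    (fun p q hpq => gaps_disj K p.2 q.2 (fun e => hpq (Subtype.ext e)))
    (by rw [gaps_iUnion hK hs ht hsub]; exact hi.mono_set sdiff_subset)
  rw [gaps_iUnion hK hs ht hsub, setIntegral_sdiff hK.measurableSet hi hsub,
    integral_Icc_eq_integral_Ioc, ← intervalIntegral.integral_of_le hst] at h1
  have e : (fun p : gaps K => ∫ r in p.1.1..p.1.2, h r)
      = fun p : gaps K => ∫ r in Ioo p.1.1 p.1.2, h r := by
    funext p
    rw [intervalIntegral.integral_of_le p.2.2.2.1.le, integral_Ioc_eq_integral_Ioo]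
  rw [e]; exact h1

section weak

variable {n : ℕ} {f : EuclideanSpace ℝ (Fin n) → ℝ} {ρ : ℝ → EuclideanSpace ℝ (Fin n) → ℝ}

lemma exists_cutoff {K : Set (EuclideanSpace ℝ (Fin n))} {R : ℝ} (hK : IsCompact K)
    (hsub : K ⊆ Metric.ball 0 R) : ∃ χ : EuclideanSpace ℝ (Fin n) → ℝ, ContDiff ℝ 2 χ ∧
      HasCompactSupport χ ∧ tsupport χ ⊆ Metric.ball 0 R ∧ (∀ x, 0 ≤ χ x) ∧ ∀ x ∈ K, χ x = 1 := by
  obtain ⟨L, hL, hKL, hLR⟩ := exists_compact_between hK Metric.isOpen_ball hsub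
  obtain ⟨χ, h1, h2, h3, h4⟩ :=
    exists_contMDiff_support_eq_eq_one_iff (modelWithCornersSelf ℝ (EuclideanSpace ℝ (Fin n)))
      (n := (2 : ℕ∞)) isOpen_interior hK.isClosed hKL
  have hts : tsupport χ ⊆ L := by
    unfold tsupport
    rw [h3]
    exact closure_minimal interior_subset hL.isClosed
  exact ⟨χ, contMDiff_iff_contDiff.mp h1, hL.of_isClosed_subset (isClosed_tsupport χ) hts,
    hts.trans hLR, fun x => (h2 ⟨x, rfl⟩).1, fun x hx => (h4 x).mp hx⟩

lemma FPSol.deriv_cont_x (S : FPSol f ρ) (t : ℝ) :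
    Continuous (fun x => deriv (fun s => ρ s x) t) := by
  have : (fun x => deriv (fun s => ρ s x) t) = wlap f (gg f ρ t) := funext fun x => S.eqn' t x
  rw [this]; exact continuous_wlap S.hf (S.gcd t)

lemma FPSol.deriv_cont_t (S : FPSol f ρ) (x) : Continuous (fun t => deriv (fun s => ρ s x) t) :=
  (S.ct x).continuous_deriv (by norm_num)

lemma FPSol.weak_step (S : FPSol f ρ) {R s t N : ℝ} {K : Set ℝ} (hK : IsClosed K) (hs : s ∈ K)
    (ht : t ∈ K) (hsub : K ⊆ Icc s t)
    (hgood : ∀ τ ∈ Icc s t, τ ∉ K → GoodAt f ρ R τ)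
    (hN : ∀ r ∈ K, ∀ x ∈ Metric.ball 0 R, |deriv (fun s => ρ s x) r| ≤ N)
    {ζ : EuclideanSpace ℝ (Fin n) → ℝ} (hζ : ContDiff ℝ 2 ζ) (hc : HasCompactSupport ζ)
    (hζs : tsupport ζ ⊆ Metric.ball 0 R) :
    mm ρ ζ t - mm ρ ζ s = ∫ r in s..t, qq f ρ ζ r := by
  have : Countable (gaps K) := (gaps_countable K).to_subtype
  have hKc : IsCompact K := isCompact_Icc.of_isClosed_subset hK hsub
  have cζ := hζ.continuous
  obtain ⟨Z, hZ⟩ := FPSol.bdd_cs cζ hc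
  have hZ0 : 0 ≤ Z := (abs_nonneg _).trans (hZ 0)
  obtain ⟨χ, hχ, hχc, hχs, hχ0, hχ1⟩ := exists_cutoff hc hζs
  obtain ⟨M, hM⟩ := FPSol.bdd_cs (S.hf.continuous.rexp.mul (continuous_wlap S.hf hχ))
    (wlap_compactSupport hχc).mul_left
  -- pointwise identity
  have hpt : ∀ x, HasSum (fun p : gaps K => ζ x * (ρ p.1.2 x - ρ p.1.1 x))
      (ζ x * (ρ t x - ρ s x) - ∫ r in K, ζ x * deriv (fun s => ρ s x) r) := by
    intro x
    have h := gaps_hasSum hK hs ht hsub (S.deriv_cont_t x)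
    have hftc : ∀ a b, ∫ r in a..b, deriv (fun s => ρ s x) r = ρ b x - ρ a x := fun a b =>
      intervalIntegral.integral_deriv_eq_sub
        (fun r _ => (S.ct x).differentiable (by norm_num) r)
        ((S.deriv_cont_t x).intervalIntegrable _ _)
    simp only [hftc] at h
    have h' := h.mul_left (ζ x)
    rwa [mul_sub, ← integral_const_mul] at h'
  -- lengths
  have hlen : Summable (fun p : gaps K => p.1.2 - p.1.1) := by
    have h := (gaps_hasSum hK hs ht hsub (h := fun _ => (1:ℝ)) continuous_const).summable
    simpa using h
  have hFi : ∀ p : gaps K, Integrable (fun x => ζ x * (ρ p.1.2 x - ρ p.1.1 x)) := fun p =>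
    (cζ.mul ((S.cx _).continuous.sub (S.cx _).continuous)).integrable_of_hasCompactSupport
      hc.mul_right
  have hFs : Summable fun p : gaps K => ∫ x, ‖ζ x * (ρ p.1.2 x - ρ p.1.1 x)‖ := by
    refine Summable.of_nonneg_of_le (fun p => integral_nonneg fun x => norm_nonneg _) (fun p => ?_)
      (hlen.mul_left (Z * (M * 2 + N * ∫ x, χ x)))
    have hk := S.kato (R := R) (N := N) p.2.2.2.1 (fun τ hτ => hgood τ
      ⟨(hsub p.2.1).1.trans hτ.1.le, hτ.2.le.trans (hsub p.2.2.1).2⟩ (p.2.2.2.2 τ hτ))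
      (hN _ p.2.1) hχ hχc hχs hχ0 hM
    have := mul_le_mul_of_nonneg_left hk hZ0
    rw [← integral_const_mul, ← mul_assoc] at this
    refine le_trans ?_ this
    refine integral_mono (hFi p).norm (Continuous.integrable_of_hasCompactSupport
      (continuous_const.mul (hχ.continuous.mul ((S.cx _).continuous.sub (S.cx _).continuous).abs))
      hχc.mul_right.mul_left) fun x => ?_
    simp only [norm_eq_abs, abs_mul]
    by_cases hx : x ∈ tsupport ζ
    · rw [hχ1 x hx, one_mul]
      exact mul_le_mul_of_nonneg_right (hZ x) (abs_nonneg _)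
    · have h1 : ζ x = 0 := image_eq_zero_of_notMem_tsupport hx
      rw [h1, abs_zero, zero_mul]
      exact mul_nonneg hZ0 (mul_nonneg (hχ0 x) (abs_nonneg _))
  have hsum1 := hasSum_integral_of_summable_integral_norm hFi hFs
  have e1 : ∀ x, ∑' p : gaps K, ζ x * (ρ p.1.2 x - ρ p.1.1 x) =
      ζ x * (ρ t x - ρ s x) - ∫ r in K, ζ x * deriv (fun s => ρ s x) r := fun x => (hpt x).tsum_eq
  simp_rw [e1] at hsum1
  -- gap contributions
  have hgap : ∀ a b, ∫ x, ζ x * (ρ b x - ρ a x) = mm ρ ζ b - mm ρ ζ a := by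
    intro a b
    unfold mm
    rw [← integral_sub (S.int_mul cζ hZ b) (S.int_mul cζ hZ a)]
    congr 1; ext x; ring
  have hgq : ∀ p : gaps K, ∫ r in p.1.1..p.1.2, qq f ρ ζ r = mm ρ ζ p.1.2 - mm ρ ζ p.1.1 := by
    intro p
    refine intervalIntegral.integral_eq_sub_of_hasDerivAt_of_le p.2.2.2.1.le
      (S.mm_cont cζ hc).continuousOn (fun τ hτ => ?_) ((S.qq_cont hζ hc).intervalIntegrable _ _)
    exact hgood τ ⟨(hsub p.2.1).1.trans hτ.1.le, hτ.2.le.trans (hsub p.2.2.1).2⟩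
      (p.2.2.2.2 τ hτ) ζ hζ hc hζs
  have hsum2 := gaps_hasSum hK hs ht hsub (S.qq_cont hζ hc)
  simp_rw [hgq] at hsum2
  simp_rw [hgap] at hsum1
  have heq := hsum1.unique hsum2
  -- Fubini on K
  have hmeas : StronglyMeasurable (Function.uncurry
      fun (r : ℝ) (x : EuclideanSpace ℝ (Fin n)) => ζ x * deriv (fun s => ρ s x) r) :=
    stronglyMeasurable_uncurry_of_continuous_of_stronglyMeasurable
      (fun x => continuous_const.mul (S.deriv_cont_t x))
      (fun r => (cζ.mul (S.deriv_cont_x r)).stronglyMeasurable)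
  have hKfin : IsFiniteMeasure (volume.restrict K) := ⟨by
    rw [Measure.restrict_apply_univ]; exact hKc.measure_lt_top⟩
  have hprod : Integrable (Function.uncurry
      fun (r : ℝ) (x : EuclideanSpace ℝ (Fin n)) => ζ x * deriv (fun s => ρ s x) r)
      ((volume.restrict K).prod volume) := by
    have hd : Integrable (fun z : ℝ × EuclideanSpace ℝ (Fin n) => (N : ℝ) * |ζ z.2|)
        ((volume.restrict K).prod volume) := by
      have := (integrable_const (μ := volume.restrict K) N).mul_prod
        (cζ.integrable_of_hasCompactSupport hc (μ := volume)).abs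
      exact this
    refine hd.mono' hmeas.aestronglyMeasurable ?_
    have hK' : ∀ᵐ z ∂((volume.restrict K).prod (volume : Measure (EuclideanSpace ℝ (Fin n)))),
        z.1 ∈ K := by
      have := (Measure.quasiMeasurePreserving_fst (μ := volume.restrict K)
        (ν := (volume : Measure (EuclideanSpace ℝ (Fin n))))).ae
        (ae_restrict_mem (μ := volume) hK.measurableSet)
      exact this
    filter_upwards [hK'] with z hz
    simp only [Function.uncurry, norm_eq_abs, abs_mul]
    by_cases hx : z.2 ∈ tsupport ζ
    · rw [mul_comm]
      exact mul_le_mul_of_nonneg_right (hN _ hz _ (hζs hx)) (abs_nonneg _)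
    · have h1 : ζ z.2 = 0 := image_eq_zero_of_notMem_tsupport hx
      simp [h1]
  have hswap : ∫ x, ∫ r in K, ζ x * deriv (fun s => ρ s x) r = ∫ r in K, qq f ρ ζ r := by
    rw [← integral_integral_swap hprod]
    congr 1; ext r
    rw [S.qq_symm hζ hc]
    simp_rw [S.eqn']
  have hmain : Integrable (fun x => ζ x * (ρ t x - ρ s x)) :=
    (cζ.mul ((S.cx _).continuous.sub (S.cx _).continuous)).integrable_of_hasCompactSupport
      hc.mul_right
  have hK2 : Integrable (fun x => ∫ r in K, ζ x * deriv (fun s => ρ s x) r) :=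
    hprod.integral_prod_right
  rw [integral_sub hmain hK2, hgap, hswap] at heq
  linarith

theorem FPSol.good (S : FPSol f ρ) (R s : ℝ) : GoodAt f ρ R s := by
  set U : Set ℝ := interior {s | GoodAt f ρ R s} with hU
  suffices h : Uᶜ = ∅ by
    have : s ∈ U := by
      by_contra hs
      have : s ∈ Uᶜ := hs
      rw [h] at this; exact this
    exact interior_subset this
  by_contra hne
  have hZ : IsClosed Uᶜ := isOpen_interior.isClosed_compl
  have : Nonempty (Uᶜ : Set ℝ) := (nonempty_iff_ne_empty.mpr hne).to_subtype
  have : CompleteSpace (Uᶜ : Set ℝ) := hZ.completeSpace_coe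
  set T : ℕ → Set ℝ := fun k => {t | ∀ x ∈ Metric.closedBall (0 : EuclideanSpace ℝ (Fin n)) R,
    |deriv (fun s => ρ s x) t| ≤ k} with hT
  have hTc : ∀ k, IsClosed (T k) := by
    intro k
    have : T k = ⋂ x ∈ Metric.closedBall (0 : EuclideanSpace ℝ (Fin n)) R,
        {t | |deriv (fun s => ρ s x) t| ≤ k} := by
      ext t; simp [hT]
    rw [this]
    exact isClosed_biInter fun x _ => isClosed_le (S.deriv_cont_t x).abs continuous_const
  have hTu : ∀ t, ∃ k, t ∈ T k := by
    intro t
    obtain ⟨C, hC⟩ := (isCompact_closedBall (0 : EuclideanSpace ℝ (Fin n)) R).exists_bound_of_continuousOn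
      (S.deriv_cont_x t).continuousOn
    obtain ⟨k, hk⟩ := exists_nat_ge C
    exact ⟨k, fun x hx => (hC x hx).trans hk⟩
  have hTm : ∀ {j k : ℕ}, j ≤ k → T j ⊆ T k := by
    intro j k hjk t ht x hx
    exact (ht x hx).trans (by exact_mod_cast hjk)
  obtain ⟨k, z, hz⟩ := nonempty_interior_of_iUnion_of_closed
    (f := fun k => (Subtype.val ⁻¹' T k : Set (Uᶜ : Set ℝ)))
    (fun k => (hTc k).preimage continuous_subtype_val)
    (by
      ext z
      simp only [mem_iUnion, mem_preimage, mem_univ, iff_true]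
      exact hTu z)
  obtain ⟨O, hO, hOe⟩ := isOpen_induced_iff.mp
    (isOpen_interior (s := (Subtype.val ⁻¹' T k : Set (Uᶜ : Set ℝ))))
  have hzO : z.1 ∈ O := by
    have : z ∈ (Subtype.val ⁻¹' O : Set (Uᶜ : Set ℝ)) := by rw [hOe]; exact hz
    exact this
  have hOT : ∀ r ∈ O, r ∉ U → r ∈ T k := by
    intro r hr hrU
    have : (⟨r, hrU⟩ : (Uᶜ : Set ℝ)) ∈ interior (Subtype.val ⁻¹' T k : Set (Uᶜ : Set ℝ)) := by
      rw [← hOe]; exact hr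
    have h2 := interior_subset this
    exact h2
  obtain ⟨ε, hε, hball⟩ := Metric.isOpen_iff.mp hO z.1 hzO
  rw [Real.ball_eq_Ioo] at hball
  have hstep : ∀ a b, a ∈ Ioo (z.1 - ε) (z.1 + ε) → b ∈ Ioo (z.1 - ε) (z.1 + ε) → a < b →
      ∀ ζ : EuclideanSpace ℝ (Fin n) → ℝ, ContDiff ℝ 2 ζ → HasCompactSupport ζ →
      tsupport ζ ⊆ Metric.ball 0 R → mm ρ ζ b - mm ρ ζ a = ∫ r in a..b, qq f ρ ζ r := by
    intro a b ha hb hab ζ h1 h2 h3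
    obtain ⟨ka, hka⟩ := hTu a
    obtain ⟨kb, hkb⟩ := hTu b
    have hK : ∀ r ∈ (Uᶜ ∩ Icc a b) ∪ {a, b}, r ∈ T (max k (max ka kb)) := by
      rintro r (⟨hr1, hr2⟩ | rfl | rfl)
      · exact hTm (le_max_left _ _) (hOT r (hball ⟨ha.1.trans_le hr2.1, hr2.2.trans_lt hb.2⟩) hr1)
      · exact hTm ((le_max_left _ _).trans (le_max_right _ _)) hka
      · exact hTm ((le_max_right _ _).trans (le_max_right _ _)) hkb
    refine S.weak_step (R := R) (N := ((max k (max ka kb) : ℕ) : ℝ))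
      (K := (Uᶜ ∩ Icc a b) ∪ {a, b}) ((hZ.inter isClosed_Icc).union (Set.toFinite _).isClosed)
      (by simp) (by simp) ?_ ?_ (fun r hr x hx => hK r hr x (Metric.ball_subset_closedBall hx))
      h1 h2 h3
    · rintro r (⟨-, hr⟩ | rfl | rfl)
      · exact hr
      · exact left_mem_Icc.mpr hab.le
      · exact right_mem_Icc.mpr hab.le
    · intro τ hτ hτK
      have : τ ∈ U := by
        by_contra h
        exact hτK (Or.inl ⟨h, hτ⟩)
      exact interior_subset this
  have hgood : Ioo (z.1 - ε) (z.1 + ε) ⊆ {s | GoodAt f ρ R s} := by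
    intro r hr ζ h1 h2 h3
    have hcq := S.qq_cont h1 h2
    have hd := (hcq.integral_hasStrictDerivAt ((z.1 - ε + r) / 2) r).hasDerivAt
    have hd2 := hd.const_add (mm ρ ζ ((z.1 - ε + r) / 2))
    refine hd2.congr_of_eventuallyEq ?_
    filter_upwards [Ioo_mem_nhds (show (z.1 - ε + r) / 2 < r by linarith [hr.1]) hr.2] with b hb
    have := hstep ((z.1 - ε + r) / 2) b ⟨by linarith [hr.1], by linarith [hr.1, hr.2]⟩
      ⟨by linarith [hr.1, hb.1], hb.2⟩ hb.1 ζ h1 h2 h3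
    linarith
  have : z.1 ∈ U := interior_maximal hgood isOpen_Ioo ⟨by linarith, by linarith⟩
  exact z.2 this

end weak

section phi

noncomputable def ph (N g : ℝ) : ℝ := g * (log g - log (g + N))
noncomputable def pd (N g : ℝ) : ℝ := log g - log (g + N) + N / (g + N)
noncomputable def pdd (N g : ℝ) : ℝ := N ^ 2 / (g * (g + N) ^ 2)

lemma pdd_pos {N g : ℝ} (hN : 0 < N) (hg : 0 < g) : 0 < pdd N g := by unfold pdd; positivity

lemma pd_deriv {N g : ℝ} (hN : 0 < N) (hg : 0 < g) : HasDerivAt (pd N) (pdd N g) g := by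
  have h0 : g + N ≠ 0 := by positivity
  have h1 : HasDerivAt (fun g : ℝ => g + N) 1 g := (hasDerivAt_id g).add_const N
  have := ((hasDerivAt_log hg.ne').sub (h1.log h0)).add ((hasDerivAt_const g N).div h1 h0)
  refine this.congr_deriv ?_
  unfold pdd
  field_simp
  ring

lemma log_gap {N g : ℝ} (hN : 0 < N) (hg : 0 < g) :
    log (g + N) - log g ≤ N / g ∧ N / (g + N) ≤ log (g + N) - log g := by
  have h0 : 0 < g + N := by positivity
  constructor
  · rw [← log_div h0.ne' hg.ne']
    have := log_le_sub_one_of_pos (div_pos h0 hg)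
    have e : (g + N) / g - 1 = N / g := by field_simp; ring
    linarith
  · have h1 : log g - log (g + N) ≤ -(N / (g + N)) := by
      rw [← log_div hg.ne' h0.ne']
      have := log_le_sub_one_of_pos (div_pos hg h0)
      have e : g / (g + N) - 1 = -(N / (g + N)) := by field_simp; ring
      linarith
    linarith

lemma ph_abs {N g : ℝ} (hN : 0 < N) (hg : 0 < g) : |ph N g| ≤ N := by
  unfold ph
  obtain ⟨h1, h2⟩ := log_gap hN hg
  have h3 : 0 ≤ N / (g + N) := by positivity
  rw [abs_mul, abs_of_pos hg, abs_of_nonpos (by linarith)]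
  calc g * -(log g - log (g + N)) ≤ g * (N / g) := by gcongr; linarith
    _ = N := by field_simp

lemma ph_tangent {N a b : ℝ} (hN : 0 < N) (ha : 0 < a) (hb : 0 < b) :
    ph N a - ph N b ≤ pd N a * (a - b) := by
  unfold ph pd
  have h : (log a - log (a + N)) - (log b - log (b + N)) ≤ N * (a - b) / ((a + N) * b) := by
    have h0 : 0 < a * (b + N) / ((a + N) * b) := by positivity
    have := log_le_sub_one_of_pos h0
    rw [log_div (by positivity) (by positivity), log_mul (by positivity) (by positivity),
      log_mul (by positivity) (by positivity)] at this
    have e : a * (b + N) / ((a + N) * b) - 1 = N * (a - b) / ((a + N) * b) := by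
      field_simp; ring
    linarith
  have h2 := mul_le_mul_of_nonneg_left h hb.le
  have e : b * (N * (a - b) / ((a + N) * b)) = N / (a + N) * (a - b) := by field_simp
  rw [e] at h2
  linarith

lemma pd_sq {N g : ℝ} (hN : 0 < N) (hg : 0 < g) : pd N g ^ 2 ≤ 32 * N * pdd N g := by
  obtain ⟨h1, h2⟩ := log_gap hN hg
  have h0 : 0 < g + N := by positivity
  have hp : 0 ≤ -pd N g := by unfold pd; linarith
  rcases le_total N g with h | h
  · have h3 : -pd N g ≤ N ^ 2 / (g * (g + N)) := by
      have e : N ^ 2 / (g * (g + N)) = N / g - N / (g + N) := by field_simp; ring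
      rw [e]; unfold pd; linarith
    have h4 := pow_le_pow_left₀ hp h3 2
    rw [neg_sq] at h4
    refine h4.trans ?_
    unfold pdd
    rw [div_pow, mul_div_assoc', div_le_div_iff₀ (by positivity) (by positivity)]
    have : N ≤ 32 * g := by linarith
    calc (N ^ 2) ^ 2 * (g * (g + N) ^ 2) = (N ^ 3 * g * (g + N) ^ 2) * N := by ring
      _ ≤ (N ^ 3 * g * (g + N) ^ 2) * (32 * g) := by gcongr
      _ = _ := by ring
  · have h3 : -pd N g ≤ 2 * √((g + N) / g) := by
      have h5 : 0 ≤ N / (g + N) := by positivity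
      have hq : 0 < √((g + N) / g) := Real.sqrt_pos.mpr (by positivity)
      have h6 := log_le_sub_one_of_pos hq
      rw [Real.log_sqrt (by positivity), log_div h0.ne' hg.ne'] at h6
      unfold pd; linarith
    have h4 := pow_le_pow_left₀ hp h3 2
    rw [neg_sq, mul_pow, Real.sq_sqrt (by positivity)] at h4
    refine h4.trans ?_
    unfold pdd
    rw [mul_div_assoc', mul_div_assoc', div_le_div_iff₀ (by positivity) (by positivity)]
    have h7 : (g + N) ^ 3 ≤ (2 * N) ^ 3 := pow_le_pow_left₀ h0.le (by linarith) 3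
    calc 2 ^ 2 * (g + N) * (g * (g + N) ^ 2) = 4 * g * (g + N) ^ 3 := by ring
      _ ≤ 4 * g * (2 * N) ^ 3 := by gcongr
      _ = _ := by ring

lemma pdd_mono {N g : ℝ} (hN : 1 ≤ N) (hg : 0 < g) : pdd 1 g ≤ pdd N g := by
  unfold pdd
  rw [div_le_div_iff₀ (by positivity) (by positivity)]
  have : (g + N) ^ 2 ≤ (N * (g + 1)) ^ 2 :=
    pow_le_pow_left₀ (by positivity) (by nlinarith) 2
  calc 1 ^ 2 * (g * (g + N) ^ 2) ≤ 1 ^ 2 * (g * (N * (g + 1)) ^ 2) := by gcongr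
    _ = _ := by ring

noncomputable def th (g : ℝ) : ℝ := 2 * arctan (√g)
noncomputable def thd (g : ℝ) : ℝ := 1 / ((1 + g) * √g)

lemma th_deriv {g : ℝ} (hg : 0 < g) : HasDerivAt th (thd g) g := by
  have := (((hasDerivAt_id g).sqrt hg.ne').arctan).const_mul 2
  refine this.congr_deriv ?_
  unfold thd
  simp only [id]
  rw [Real.sq_sqrt hg.le]
  have := (Real.sqrt_pos.mpr hg).ne'
  field_simp

lemma thd_pos {g : ℝ} (hg : 0 < g) : 0 < thd g := by
  unfold thd
  have := (Real.sqrt_pos.mpr hg)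
  positivity

lemma thd_sq {g : ℝ} (hg : 0 < g) : thd g ^ 2 = pdd 1 g := by
  unfold thd pdd
  rw [div_pow, mul_pow, Real.sq_sqrt hg.le]
  ring

lemma th_abs (g : ℝ) : |th g| ≤ π := by
  unfold th
  have h1 := arctan_lt_pi_div_two (√g)
  have h2 := neg_pi_div_two_lt_arctan (√g)
  rw [abs_le]; constructor <;> linarith

variable {n : ℕ}

lemma th_contDiff {g : EuclideanSpace ℝ (Fin n) → ℝ} (h : ContDiff ℝ 2 g) (h0 : ∀ x, 0 < g x) :
    ContDiff ℝ 2 (fun x => th (g x)) := by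
  unfold th
  exact contDiff_const.mul ((contDiff_arctan).comp (h.sqrt fun x => (h0 x).ne'))

lemma pd_contDiff {g : EuclideanSpace ℝ (Fin n) → ℝ} (h : ContDiff ℝ 2 g) (h0 : ∀ x, 0 < g x)
    {N : ℝ} (hN : 0 < N) : ContDiff ℝ 2 (fun x => pd N (g x)) := by
  unfold pd
  have hp : ∀ x, g x + N ≠ 0 := fun x => (add_pos (h0 x) hN).ne'
  exact ((h.log fun x => (h0 x).ne').sub ((h.add contDiff_const).log hp)).add
    (contDiff_const.div (h.add contDiff_const) hp)

lemma ph_cont {X : Type*} [TopologicalSpace X] {g : X → ℝ} (h : Continuous g) (h0 : ∀ x, 0 < g x)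
    {N : ℝ} (hN : 0 < N) : Continuous (fun x => ph N (g x)) := by
  unfold ph
  have hp : ∀ x, g x + N ≠ 0 := fun x => (add_pos (h0 x) hN).ne'
  exact h.mul ((h.log fun x => (h0 x).ne').sub ((h.add continuous_const).log hp))

end phi

section ent

variable {n : ℕ} {f : EuclideanSpace ℝ (Fin n) → ℝ} {ρ : ℝ → EuclideanSpace ℝ (Fin n) → ℝ}

lemma vdiv_compactSupport {V : EuclideanSpace ℝ (Fin n) → EuclideanSpace ℝ (Fin n)}
    (h : HasCompactSupport V) : HasCompactSupport (vdiv V) := by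
  refine HasCompactSupport.intro h (fun x hx => ?_)
  unfold vdiv
  refine Finset.sum_eq_zero fun i _ => ?_
  have h1 := notMem_tsupport_iff_eventuallyEq.mp hx
  have : (fun y => V y i) =ᶠ[𝓝 x] fun _ => 0 := by
    filter_upwards [h1] with y hy
    rw [hy]; rfl
  rw [this.fderiv_eq]; simp

/-- local Fisher-type information -/
noncomputable def DD (f : EuclideanSpace ℝ (Fin n) → ℝ) (ρ : ℝ → EuclideanSpace ℝ (Fin n) → ℝ)
    (η : EuclideanSpace ℝ (Fin n) → ℝ) (τ : ℝ) : ℝ :=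
  ∫ x, exp (-f x) * (η x ^ 2 * ‖gradient (fun y => th (gg f ρ τ y)) x‖ ^ 2)

lemma FPSol.DD_int (S : FPSol f ρ) {η : EuclideanSpace ℝ (Fin n) → ℝ} (hη : ContDiff ℝ 2 η)
    (hc : HasCompactSupport η) (τ : ℝ) :
    Integrable (fun x => exp (-f x) * (η x ^ 2 * ‖gradient (fun y => th (gg f ρ τ y)) x‖ ^ 2)) := by
  have hu := th_contDiff (S.gcd τ) (S.gpos τ)
  refine Continuous.integrable_of_hasCompactSupport
    ((contDiff_expneg S.hf).continuous.mul ((hη.continuous.pow 2).mul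
      ((continuous_gradient (hu.of_le (by norm_num))).norm.pow 2))) ?_
  refine HasCompactSupport.intro hc fun x hx => ?_
  simp [image_eq_zero_of_notMem_tsupport hx]

lemma FPSol.DD_lower (S : FPSol f ρ) {η : EuclideanSpace ℝ (Fin n) → ℝ} (hη : ContDiff ℝ 2 η)
    (hc : HasCompactSupport η) {t : ℝ} (hpos : 0 < DD f ρ η t) :
    ∃ δ > 0, ∀ τ ∈ Ioo t (t + δ), DD f ρ η t / 2 ≤ DD f ρ η τ := by
  have hu : ∀ τ, ContDiff ℝ 2 (fun y => th (gg f ρ τ y)) := fun τ =>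
    th_contDiff (S.gcd τ) (S.gpos τ)
  set W : EuclideanSpace ℝ (Fin n) → EuclideanSpace ℝ (Fin n) := fun x =>
    (exp (-f x) * η x ^ 2) • gradient (fun y => th (gg f ρ t y)) x with hW
  have hWd : ContDiff ℝ 1 W :=
    (((contDiff_expneg S.hf).mul (hη.pow 2)).of_le (by norm_num)).smul (contDiff_gradient (hu t))
  have hWc : HasCompactSupport W := by
    refine HasCompactSupport.intro hc fun x hx => ?_
    simp [hW, image_eq_zero_of_notMem_tsupport hx]
  have hB : ∀ τ, ∫ x, inner ℝ (gradient (fun y => th (gg f ρ τ y)) x) (W x)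
      = -∫ x, th (gg f ρ τ x) * vdiv W x := fun τ => by
    rw [ibp ((hu τ).of_le (by norm_num)) hWd (Or.inr hWc), neg_neg]
  have hBc : Continuous fun τ => ∫ x, th (gg f ρ τ x) * vdiv W x := by
    refine continuous_of_dominated (bound := fun x => π * |vdiv W x|)
      (fun τ => ((hu τ).continuous.mul (continuous_vdiv hWd)).aestronglyMeasurable) ?_ ?_ ?_
    · intro τ
      refine ae_of_all _ fun x => ?_
      rw [norm_eq_abs, abs_mul]
      exact mul_le_mul_of_nonneg_right (th_abs _) (abs_nonneg _)
    · exact (((continuous_vdiv hWd).integrable_of_hasCompactSupport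
        (vdiv_compactSupport hWc)).abs).const_mul π
    · refine ae_of_all _ fun x => ?_
      unfold th
      exact (continuous_const.mul (continuous_arctan.comp (S.gcont_t x).sqrt)).mul continuous_const
  have hDB : ∀ τ, 2 * (∫ x, inner ℝ (gradient (fun y => th (gg f ρ τ y)) x) (W x)) - DD f ρ η t
      ≤ DD f ρ η τ := by
    intro τ
    have iB : Integrable (fun x => inner ℝ (gradient (fun y => th (gg f ρ τ y)) x) (W x)) := by
      refine Continuous.integrable_of_hasCompactSupport
        ((continuous_gradient ((hu τ).of_le (by norm_num))).inner hWd.continuous) ?_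
      refine hWc.mono fun x hx => ?_
      simp only [Function.mem_support] at hx ⊢
      intro h; apply hx; simp [h]
    unfold DD
    rw [← integral_const_mul, ← integral_sub (iB.const_mul 2) (S.DD_int hη hc t)]
    refine integral_mono ((iB.const_mul 2).sub (S.DD_int hη hc t)) (S.DD_int hη hc τ) fun x => ?_
    simp only [hW, inner_smul_right]
    set p := gradient (fun y => th (gg f ρ τ y)) x
    set q := gradient (fun y => th (gg f ρ t y)) x
    have h1 : 0 ≤ ‖p - q‖ ^ 2 := sq_nonneg _
    rw [norm_sub_sq_real] at h1
    have h2 : 0 ≤ exp (-f x) * η x ^ 2 := by positivity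
    have := mul_nonneg h2 h1
    linarith
  have hBt : ∫ x, inner ℝ (gradient (fun y => th (gg f ρ t y)) x) (W x) = DD f ρ η t := by
    unfold DD
    congr 1; ext x
    simp only [hW, inner_smul_right, real_inner_self_eq_norm_sq]
    ring
  have hcont : Continuous fun τ =>
      2 * (∫ x, inner ℝ (gradient (fun y => th (gg f ρ τ y)) x) (W x)) - DD f ρ η t := by
    simp_rw [hB]
    exact (continuous_const.mul hBc.neg).sub continuous_const
  have hev : ∀ᶠ τ in 𝓝 t, DD f ρ η t / 2 <
      2 * (∫ x, inner ℝ (gradient (fun y => th (gg f ρ τ y)) x) (W x)) - DD f ρ η t := by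
    refine (hcont.tendsto t).eventually (lt_mem_nhds ?_)
    rw [hBt]; linarith
  obtain ⟨δ, hδ, hb⟩ := Metric.eventually_nhds_iff.mp hev
  refine ⟨δ, hδ, fun τ hτ => ?_⟩
  have := hb (y := τ) (by rw [Real.dist_eq, abs_lt]; constructor <;> linarith [hτ.1, hτ.2])
  linarith [hDB τ]

lemma FPSol.DD_pos (S : FPSol f ρ) {η : EuclideanSpace ℝ (Fin n) → ℝ} (hη : ContDiff ℝ 2 η)
    (hc : HasCompactSupport η) {t : ℝ} {x₀} (h1 : η x₀ ≠ 0) (h2 : gradient (gg f ρ t) x₀ ≠ 0) :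
    0 < DD f ρ η t := by
  unfold DD
  have hu := th_contDiff (S.gcd t) (S.gpos t)
  refine Continuous.integral_pos_of_hasCompactSupport_nonneg_nonzero (x := x₀)
    ((contDiff_expneg S.hf).continuous.mul ((hη.continuous.pow 2).mul
      ((continuous_gradient (hu.of_le (by norm_num))).norm.pow 2))) ?_ ?_ ?_
  · refine HasCompactSupport.intro hc fun x hx => ?_
    simp [image_eq_zero_of_notMem_tsupport hx]
  · intro x; simp only [Pi.zero_apply]; positivity
  · rw [gradient_comp' (th_deriv (S.gpos t x₀)) ((S.gcd t).differentiable (by norm_num) x₀)]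
    have h3 := (thd_pos (S.gpos t x₀)).ne'
    have h4 : ‖thd (gg f ρ t x₀) • gradient (gg f ρ t) x₀‖ ≠ 0 := by
      rw [norm_ne_zero_iff]; exact smul_ne_zero h3 h2
    exact mul_ne_zero (exp_pos _).ne' (mul_ne_zero (pow_ne_zero 2 h1) (pow_ne_zero 2 h4))

lemma FPSol.Yint (S : FPSol f ρ) {N : ℝ} (hN : 0 < N) {b : EuclideanSpace ℝ (Fin n) → ℝ}
    (hb : Continuous b) (h1 : ∀ x, |b x| ≤ 1) (τ : ℝ) :
    Integrable (fun x => b x * (exp (-f x) * ph N (gg f ρ τ x))) := by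
  refine (S.intν.const_mul N).mono' (hb.mul ((contDiff_expneg S.hf).continuous.mul
    (ph_cont (S.gcd τ).continuous (S.gpos τ) hN))).aestronglyMeasurable (ae_of_all _ fun x => ?_)
  rw [norm_eq_abs, abs_mul, abs_mul, abs_of_pos (exp_pos (-f x))]
  calc |b x| * (exp (-f x) * |ph N (gg f ρ τ x)|) ≤ 1 * (exp (-f x) * N) := by
        gcongr
        · exact h1 x
        · exact ph_abs hN (S.gpos τ x)
    _ = N * exp (-f x) := by ring

lemma FPSol.ent_cut (S : FPSol f ρ) {N G c t h : ℝ} (hN : 1 ≤ N) (hh : 0 < h)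
    {η η₁ : EuclideanSpace ℝ (Fin n) → ℝ} (hη : ContDiff ℝ 2 η) (hc : HasCompactSupport η)
    (hη₁ : ContDiff ℝ 2 η₁) (hc₁ : HasCompactSupport η₁)
    (h1 : ∀ x, |η x| ≤ 1) (hle : ∀ x, η₁ x ^ 2 ≤ η x ^ 2) (hG : ∀ x, ‖gradient η x‖ ≤ G)
    (hD : ∀ τ ∈ Ioo t (t + h), c ≤ DD f ρ η₁ τ) :
    (∫ x, η x ^ 2 * (exp (-f x) * ph N (gg f ρ (t + h) x))) -
      (∫ x, η x ^ 2 * (exp (-f x) * ph N (gg f ρ t x))) ≤ (-(c / 2) + 64 * N * G ^ 2) * h := by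
  have hN0 : 0 < N := by linarith
  have hb1 : ∀ x, |η x ^ 2| ≤ 1 := fun x => by
    rw [abs_pow]; exact pow_le_one₀ (abs_nonneg _) (h1 x)
  have hbc : Continuous (fun x => η x ^ 2) := hη.continuous.pow 2
  have ce : Continuous (fun x => exp (-f x)) := (contDiff_expneg S.hf).continuous
  have hG0 : 0 ≤ G := (norm_nonneg _).trans (hG 0)
  have hYi := fun τ => S.Yint hN0 hbc hb1 τ
  have hYc : Continuous fun τ => ∫ x, η x ^ 2 * (exp (-f x) * ph N (gg f ρ τ x)) := by
    refine continuous_of_dominated (bound := fun x => N * exp (-f x))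
      (fun τ => (hYi τ).aestronglyMeasurable) ?_ (S.intν.const_mul N) ?_
    · intro τ
      refine ae_of_all _ fun x => ?_
      rw [norm_eq_abs, abs_mul, abs_mul, abs_of_pos (exp_pos (-f x))]
      calc |η x ^ 2| * (exp (-f x) * |ph N (gg f ρ τ x)|) ≤ 1 * (exp (-f x) * N) := by
            gcongr
            · exact hb1 x
            · exact ph_abs hN0 (S.gpos τ x)
        _ = N * exp (-f x) := by ring
    · exact ae_of_all _ fun x => continuous_const.mul (continuous_const.mul
        (ph_cont (S.gcont_t x) (fun s => S.gpos s x) hN0))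
  have hd := dini (C := -(c / 2) + 64 * N * G ^ 2) (show t < t + h by linarith)
    hYc.continuousOn (by
      intro τ hτ
      have hχ : ContDiff ℝ 2 (fun x => η x ^ 2) := hη.pow 2
      have hχc : HasCompactSupport (fun x => η x ^ 2) :=
        hc.comp_left (g := fun y : ℝ => y ^ 2) (by simp)
      have hψ := pd_contDiff (S.gcd τ) (S.gpos τ) hN0
      set ζ : EuclideanSpace ℝ (Fin n) → ℝ := fun x => η x ^ 2 * pd N (gg f ρ τ x) with hζ
      have hζd : ContDiff ℝ 2 ζ := hχ.mul hψ
      have hζc : HasCompactSupport ζ := hχc.mul_right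
      obtain ⟨R, hR⟩ := hζc.isBounded.subset_ball 0
      refine ⟨mm ρ ζ, qq f ρ ζ τ, ?_, S.good R τ ζ hζd hζc hR, ?_⟩
      · rw [S.qq_symm hζd hζc, hζ, comp_ibp S.hf hχ hχc (S.gcd τ)
          (fun x => pd_deriv hN0 (S.gpos τ x)) hψ]
        have hDτ := hD τ hτ
        have cg : Continuous (gradient (gg f ρ τ)) :=
          continuous_gradient ((S.gcd τ).of_le (by norm_num))
        have cpdd : Continuous (fun x => pdd N (gg f ρ τ x)) := by
          unfold pdd
          have := (S.gcd τ).continuous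
          refine continuous_const.div (by fun_prop) fun x => ?_
          have := S.gpos τ x
          positivity
        have iI : Integrable (fun x => exp (-f x) * (η x ^ 2 * (pdd N (gg f ρ τ x) *
            ‖gradient (gg f ρ τ) x‖ ^ 2) + pd N (gg f ρ τ x) *
            inner ℝ (gradient (fun x => η x ^ 2) x) (gradient (gg f ρ τ) x))) := by
          refine Continuous.integrable_of_hasCompactSupport
            (ce.mul ((hbc.mul (cpdd.mul (cg.norm.pow 2))).add (hψ.continuous.mul
              ((continuous_gradient (hχ.of_le (by norm_num))).inner cg)))) ?_
          refine HasCompactSupport.intro hχc fun x hx => ?_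
          have e1 : η x ^ 2 = 0 :=
            image_eq_zero_of_notMem_tsupport (f := fun x => η x ^ 2) hx
          have e2 : gradient (fun x => η x ^ 2) x = 0 := by
            have := notMem_tsupport_iff_eventuallyEq.mp hx
            rw [this.gradient_eq]; exact gradient_const _ _
          simp only [e2, inner_zero_left, e1]
          simp
        have hmain : (1 / 2) * DD f ρ η₁ τ - 64 * N * G ^ 2 ≤ ∫ x, exp (-f x) *
            (η x ^ 2 * (pdd N (gg f ρ τ x) * ‖gradient (gg f ρ τ) x‖ ^ 2) + pd N (gg f ρ τ x) *
            inner ℝ (gradient (fun x => η x ^ 2) x) (gradient (gg f ρ τ) x)) := by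
          have e : (64 * N * G ^ 2) = ∫ x, (64 * N * G ^ 2) * exp (-f x) := by
            rw [integral_const_mul, S.hν, mul_one]
          rw [e]
          unfold DD
          have iD := (S.DD_int hη₁ hc₁ τ).const_mul (1 / 2)
          rw [← integral_const_mul, ← integral_sub iD (S.intν.const_mul _)]
          refine integral_mono (iD.sub (S.intν.const_mul _)) iI fun x => ?_
          simp only
          have hg := S.gpos τ x
          rw [gradient_comp' (th_deriv hg) ((S.gcd τ).differentiable (by norm_num) x),
            gradient_comp' (φ := fun y => y ^ 2) (φ' := 2 * η x) (by simpa using hasDerivAt_pow 2 (η x))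
              (hη.differentiable (by norm_num) x), norm_smul, mul_pow, norm_eq_abs, sq_abs,
            thd_sq hg, inner_smul_left]
          simp only [conj_trivial]
          set P := pdd N (gg f ρ τ x) with hP
          set P1 := pdd 1 (gg f ρ τ x) with hP1
          set p := pd N (gg f ρ τ x) with hp
          set s := ‖gradient (gg f ρ τ) x‖ with hs
          set I := inner ℝ (gradient η x) (gradient (gg f ρ τ) x) with hI
          have hP0 : 0 < P := pdd_pos hN0 hg
          have hP10 : 0 < P1 := pdd_pos one_pos hg
          have hPP : P1 ≤ P := pdd_mono hN hg
          have hpP : p ^ 2 ≤ 32 * N * P := pd_sq hN0 hg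
          have hs0 : 0 ≤ s := norm_nonneg _
          have hIa : |I| ≤ G * s := (abs_real_inner_le_norm _ _).trans
            (mul_le_mul_of_nonneg_right (hG x) hs0)
          have k1 : η₁ x ^ 2 * (P1 * s ^ 2) ≤ η x ^ 2 * (P * s ^ 2) :=
            mul_le_mul (hle x) (mul_le_mul_of_nonneg_right hPP (sq_nonneg s)) (by positivity)
              (sq_nonneg _)
          have k2 : I ^ 2 ≤ (G * s) ^ 2 := sq_le_sq' (by linarith [neg_abs_le I, hIa])
            ((le_abs_self I).trans hIa)
          have k3 : 0 ≤ (1 / 2) * (η x ^ 2 * (P * s ^ 2)) + 2 * η x * p * I + 64 * N * G ^ 2 := by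
            rcases eq_or_lt_of_le hs0 with h0 | h0
            · have hI0 : I = 0 := by
                have : |I| ≤ 0 := by rw [← h0] at hIa; simpa using hIa
                exact abs_nonpos_iff.mp this
              rw [hI0, ← h0]
              have : 0 ≤ 64 * N * G ^ 2 := by positivity
              simpa using this
            · have hsq : 0 ≤ (η x * P * s ^ 2 + 2 * p * I) ^ 2 := sq_nonneg _
              have k4 : p ^ 2 * I ^ 2 ≤ (32 * N * P) * (G * s) ^ 2 :=
                mul_le_mul hpP k2 (sq_nonneg _) (by positivity)
              have k5 : 0 ≤ (2 * P * s ^ 2) * ((1 / 2) * (η x ^ 2 * (P * s ^ 2))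
                  + 2 * η x * p * I + 64 * N * G ^ 2) := by nlinarith
              exact nonneg_of_mul_nonneg_right k5 (by positivity)
          have := mul_nonneg (exp_pos (-f x)).le k3
          have := mul_le_mul_of_nonneg_left k1 (exp_pos (-f x)).le
          linarith
        linarith
      · intro τ' hτ'
        obtain ⟨Z, hZ⟩ := FPSol.bdd_cs hζd.continuous hζc
        unfold mm
        rw [← integral_sub (S.int_mul hζd.continuous hZ τ) (S.int_mul hζd.continuous hZ τ'),
          ← integral_sub (hYi τ) (hYi τ')]
        refine integral_mono ((hYi τ).sub (hYi τ'))
          ((S.int_mul hζd.continuous hZ τ).sub (S.int_mul hζd.continuous hZ τ')) fun x => ?_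
        simp only
        rw [← S.eg τ x, ← S.eg τ' x, hζ]
        have hj := ph_tangent hN0 (S.gpos τ x) (S.gpos τ' x)
        have := mul_le_mul_of_nonneg_left hj (mul_nonneg (sq_nonneg (η x)) (exp_pos (-f x)).le)
        simp only
        linarith)
  have e : t + h - t = h := by ring
  rw [e] at hd
  exact hd

end ent

section limit

variable {n : ℕ} {f : EuclideanSpace ℝ (Fin n) → ℝ} {ρ : ℝ → EuclideanSpace ℝ (Fin n) → ℝ}

lemma exists_etas (n : ℕ) : ∃ (G : ℝ) (η : ℕ → EuclideanSpace ℝ (Fin n) → ℝ),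
    ∀ k : ℕ, ContDiff ℝ 2 (η k) ∧ HasCompactSupport (η k) ∧ (∀ x, |η k x| ≤ 1) ∧
      (∀ x, ‖gradient (η k) x‖ ≤ G / (k + 1)) ∧ ∀ x, ‖x‖ ≤ k + 1 → η k x = 1 := by
  let b : ContDiffBump (0 : EuclideanSpace ℝ (Fin n)) := ⟨1, 2, one_pos, by norm_num⟩
  have hb : ContDiff ℝ 2 b := b.contDiff
  obtain ⟨G, hG⟩ := (gradient_compactSupport b.hasCompactSupport).exists_bound_of_continuous
    (continuous_gradient (hb.of_le (by norm_num)))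
  refine ⟨G, fun k x => b (((k : ℝ) + 1)⁻¹ • x), fun k => ?_⟩
  have hk : (0 : ℝ) < (k : ℝ) + 1 := by positivity
  refine ⟨hb.comp (contDiff_const_smul _), ?_, ?_, ?_, ?_⟩
  · exact b.hasCompactSupport.comp_smul (inv_ne_zero hk.ne')
  · intro x
    rw [abs_of_nonneg b.nonneg]; exact b.le_one
  · intro x
    have h := hG (((k : ℝ) + 1)⁻¹ • x)
    unfold gradient at h ⊢
    rw [LinearIsometryEquiv.norm_map] at h ⊢
    rw [fderiv_comp_smul, norm_smul, norm_eq_abs, abs_of_pos (inv_pos.mpr hk), div_eq_inv_mul]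
    exact mul_le_mul_of_nonneg_left h (inv_pos.mpr hk).le
  · intro x hx
    apply b.one_of_mem_closedBall
    rw [mem_closedBall_zero_iff, norm_smul, norm_eq_abs, abs_of_pos (inv_pos.mpr hk)]
    rw [inv_mul_le_iff₀ hk]
    have : ‖x‖ ≤ ((k : ℝ) + 1) * 1 := by linarith
    exact this

lemma FPSol.ent_full (S : FPSol f ρ) {N c t h : ℝ} (hN : 1 ≤ N) (hh : 0 < h)
    {η₁ : EuclideanSpace ℝ (Fin n) → ℝ}
    (hη₁ : ContDiff ℝ 2 η₁) (hc₁ : HasCompactSupport η₁) (h1 : ∀ x, |η₁ x| ≤ 1)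
    (hD : ∀ τ ∈ Ioo t (t + h), c ≤ DD f ρ η₁ τ) :
    (∫ x, exp (-f x) * ph N (gg f ρ (t + h) x)) -
      (∫ x, exp (-f x) * ph N (gg f ρ t x)) ≤ -(c / 2) * h := by
  have hN0 : 0 < N := by linarith
  obtain ⟨G, η, hη⟩ := exists_etas n
  have hlim : ∀ τ, Tendsto (fun k => ∫ x, η k x ^ 2 * (exp (-f x) * ph N (gg f ρ τ x))) atTop
      (𝓝 (∫ x, exp (-f x) * ph N (gg f ρ τ x))) := by
    intro τ
    have hb1 : ∀ k x, |η k x ^ 2| ≤ 1 := fun k x => by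
      rw [abs_pow]; exact pow_le_one₀ (abs_nonneg _) ((hη k).2.2.1 x)
    refine tendsto_integral_of_dominated_convergence (fun x => N * exp (-f x))
      (fun k => (S.Yint hN0 ((hη k).1.continuous.pow 2) (hb1 k) τ).aestronglyMeasurable)
      (S.intν.const_mul N) ?_ ?_
    · intro k
      refine ae_of_all _ fun x => ?_
      rw [norm_eq_abs, abs_mul, abs_mul, abs_of_pos (exp_pos (-f x))]
      calc |η k x ^ 2| * (exp (-f x) * |ph N (gg f ρ τ x)|) ≤ 1 * (exp (-f x) * N) := by
            gcongr
            · exact hb1 k x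
            · exact ph_abs hN0 (S.gpos τ x)
        _ = N * exp (-f x) := by ring
    · refine ae_of_all _ fun x => ?_
      refine tendsto_const_nhds.congr' ?_
      obtain ⟨k0, hk0⟩ := exists_nat_ge ‖x‖
      filter_upwards [eventually_ge_atTop k0] with k hk
      have : (k0 : ℝ) ≤ k := by exact_mod_cast hk
      rw [(hη k).2.2.2.2 x (by linarith)]; ring
  have hr : Tendsto (fun k : ℕ => (-(c / 2) + 64 * N * (G / ((k : ℝ) + 1)) ^ 2) * h) atTop
      (𝓝 ((-(c / 2) + 64 * N * 0 ^ 2) * h)) := by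
    have h0 : Tendsto (fun k : ℕ => G / ((k : ℝ) + 1)) atTop (𝓝 0) :=
      tendsto_const_nhds.div_atTop (tendsto_atTop_add_const_right _ _ tendsto_natCast_atTop_atTop)
    exact ((h0.pow 2).const_mul (64 * N)).const_add _ |>.mul_const h
  have e : (-(c / 2) + 64 * N * 0 ^ 2) * h = -(c / 2) * h := by ring
  rw [e] at hr
  refine le_of_tendsto_of_tendsto ((hlim (t + h)).sub (hlim t)) hr ?_
  obtain ⟨R, hR⟩ := hc₁.isBounded.subset_ball 0
  obtain ⟨k0, hk0⟩ := exists_nat_ge R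
  filter_upwards [eventually_ge_atTop k0] with k hk
  have hkk : (k0 : ℝ) ≤ k := by exact_mod_cast hk
  obtain ⟨g1, g2, g3, g4, g5⟩ := hη k
  refine S.ent_cut hN hh g1 g2 hη₁ hc₁ g3 (fun x => ?_) g4 hD
  by_cases hx : x ∈ tsupport η₁
  · have := hR hx
    rw [mem_ball_zero_iff] at this
    rw [g5 x (by linarith), one_pow, ← sq_abs]
    exact pow_le_one₀ (abs_nonneg _) (h1 x)
  · rw [image_eq_zero_of_notMem_tsupport hx]; simp only [ne_eq, OfNat.ofNat_ne_zero, not_false_eq_true, zero_pow]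
    positivity

lemma FPSol.ent_lim (S : FPSol f ρ) {τ : ℝ}
    (hi : Integrable (fun x => ρ τ x * log (gg f ρ τ x))) :
    Tendsto (fun N : ℕ => (∫ x, exp (-f x) * ph ((N : ℝ) + 1) (gg f ρ τ x)) + log ((N : ℝ) + 1))
      atTop (𝓝 (∫ x, ρ τ x * log (gg f ρ τ x))) := by
  have hN0 : ∀ N : ℕ, (0 : ℝ) < (N : ℝ) + 1 := fun N => by positivity
  have e : ∀ N : ℕ, (∫ x, exp (-f x) * ph ((N : ℝ) + 1) (gg f ρ τ x)) + log ((N : ℝ) + 1)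
      = ∫ x, ρ τ x * (log (gg f ρ τ x) - log (gg f ρ τ x + ((N : ℝ) + 1)) + log ((N : ℝ) + 1)) := by
    intro N
    have e1 : log ((N : ℝ) + 1) = ∫ x, ρ τ x * log ((N : ℝ) + 1) := by
      rw [integral_mul_const, S.prob, one_mul]
    have i1 := S.Yint (hN0 N) (b := fun _ => 1) continuous_const (by simp) τ
    simp only [one_mul] at i1
    nth_rewrite 1 [e1]
    rw [← integral_add i1 ((S.int τ).mul_const _)]
    congr 1; ext x
    unfold ph
    rw [← mul_assoc, S.eg]; ring
  simp_rw [e]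
  have cg := (S.gcd τ).continuous
  have hg := S.gpos τ
  refine tendsto_integral_of_dominated_convergence
    (fun x => 2 * |ρ τ x * log (gg f ρ τ x)| + ρ τ x) (fun N => ?_)
    ((hi.abs.const_mul 2).add (S.int τ)) ?_ ?_
  · refine Continuous.aestronglyMeasurable ((S.cx τ).continuous.mul (((cg.log fun x => (hg x).ne').sub
      ((cg.add continuous_const).log fun x => ?_)).add continuous_const))
    exact (add_pos (hg x) (hN0 N)).ne'
  · intro N
    refine ae_of_all _ fun x => ?_
    have hgx := hg x
    have hN := hN0 N
    have hρ := S.pos τ x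
    rw [norm_eq_abs, abs_mul, abs_mul, abs_of_pos hρ]
    set g := gg f ρ τ x
    have k1 : 0 ≤ log (g + ((N : ℝ) + 1)) - log ((N : ℝ) + 1) := by
      have := log_le_log hN (show (N : ℝ) + 1 ≤ g + ((N : ℝ) + 1) by linarith)
      linarith
    have k2 : log (g + ((N : ℝ) + 1)) - log ((N : ℝ) + 1) ≤ 1 + |log g| := by
      rw [← log_div (by positivity) hN.ne']
      have k3 : (g + ((N : ℝ) + 1)) / ((N : ℝ) + 1) ≤ g + 1 := by
        rw [div_le_iff₀ hN]
        have : (0 : ℝ) ≤ N := by positivity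
        nlinarith [mul_nonneg hgx.le this]
      have k4 := log_le_log (by positivity) k3
      refine k4.trans ?_
      rcases le_total g 1 with h | h
      · have : log (g + 1) ≤ g := by have := log_le_sub_one_of_pos (show 0 < g + 1 by linarith); linarith
        have := abs_nonneg (log g)
        linarith
      · have h5 : log (g + 1) ≤ log (2 * g) := log_le_log (by linarith) (by linarith)
        rw [log_mul (by norm_num) hgx.ne'] at h5
        have h6 : log 2 ≤ 1 := by have := log_le_sub_one_of_pos (show (0:ℝ) < 2 by norm_num); linarith
        have := le_abs_self (log g)
        linarith
    have k5 : |log g - log (g + ((N : ℝ) + 1)) + log ((N : ℝ) + 1)| ≤ 2 * |log g| + 1 := by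
      have := le_abs_self (log g)
      have := neg_abs_le (log g)
      rw [abs_le]; constructor <;> linarith
    calc _ ≤ ρ τ x * (2 * |log g| + 1) := mul_le_mul_of_nonneg_left k5 hρ.le
      _ = _ := by ring
  · refine ae_of_all _ fun x => ?_
    have hgx := hg x
    set g := gg f ρ τ x
    have k0 : Tendsto (fun N : ℕ => g / ((N : ℝ) + 1) + 1) atTop (𝓝 (0 + 1)) :=
      ((tendsto_const_nhds.div_atTop (tendsto_atTop_add_const_right _ _
        tendsto_natCast_atTop_atTop)).add_const 1)
    rw [zero_add] at k0
    have k1 := (k0.log one_ne_zero)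
    rw [log_one] at k1
    have k2 := (k1.const_sub (log g)).const_mul (ρ τ x)
    rw [sub_zero] at k2
    refine k2.congr fun N => ?_
    have hN := hN0 N
    have : g / ((N : ℝ) + 1) + 1 = (g + ((N : ℝ) + 1)) / ((N : ℝ) + 1) := by field_simp
    rw [this, log_div (by positivity) hN.ne']
    ring

lemma FPSol.ent_decay (S : FPSol f ρ) {t : ℝ} {x₀} (hx : gradient (gg f ρ t) x₀ ≠ 0)
    (hi : Integrable (fun x => ρ t x * log (gg f ρ t x))) :
    ∃ c > 0, ∃ δ > 0, ∀ h ∈ Ioo 0 δ,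
      Integrable (fun x => ρ (t + h) x * log (gg f ρ (t + h) x)) →
      (∫ x, ρ (t + h) x * log (gg f ρ (t + h) x)) - (∫ x, ρ t x * log (gg f ρ t x)) ≤ -c * h := by
  let b : ContDiffBump x₀ := ⟨1, 2, one_pos, by norm_num⟩
  have hb : ContDiff ℝ 2 b := b.contDiff
  have hb1 : ∀ x, |b x| ≤ 1 := fun x => by rw [abs_of_nonneg b.nonneg]; exact b.le_one
  have hpos : 0 < DD f ρ b t := S.DD_pos hb b.hasCompactSupport (x₀ := x₀)
    (by rw [b.one_of_mem_closedBall (by simp [b])]; exact one_ne_zero) hx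
  obtain ⟨δ, hδ, hD⟩ := S.DD_lower hb b.hasCompactSupport hpos
  refine ⟨DD f ρ b t / 2 / 2, by positivity, δ, hδ, fun h hh hi2 => ?_⟩
  refine le_of_tendsto ((S.ent_lim hi2).sub (S.ent_lim hi)) (Eventually.of_forall fun N => ?_)
  have := S.ent_full (N := (N : ℝ) + 1) (c := DD f ρ b t / 2) (t := t) (h := h)
    (by have : (0 : ℝ) ≤ N := by positivity
        linarith) hh.1 hb b.hasCompactSupport hb1
    (fun τ hτ => hD τ ⟨hτ.1, by linarith [hτ.2, hh.2]⟩)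
  linarith

end limit

section fin

variable {n : ℕ} {f : EuclideanSpace ℝ (Fin n) → ℝ} {ρ : ℝ → EuclideanSpace ℝ (Fin n) → ℝ}

lemma flux_eq (hf : ContDiff ℝ 2 f) {r : EuclideanSpace ℝ (Fin n) → ℝ} (hr : ContDiff ℝ 2 r) (y) :
    r y • gradient f y + gradient r y
      = exp (-f y) • gradient (fun z => r z * exp (f z)) y := by
  have h1 := hf.differentiable (by norm_num) y
  rw [gradient_mul' (hr.differentiable (by norm_num) y) h1.exp,
    gradient_comp' (Real.hasDerivAt_exp (f y)) h1, smul_add, smul_smul, smul_smul, smul_smul]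
  have e : exp (-f y) * exp (f y) = 1 := by rw [← exp_add]; simp
  rw [show exp (-f y) * r y * exp (f y) = r y * (exp (-f y) * exp (f y)) by ring, e]
  simp

/-- Zero relative entropy forces the density ratio to be constant. -/
lemma FPSol.ent_zero (S : FPSol f ρ) {t : ℝ}
    (hi : Integrable (fun x => ρ t x * log (gg f ρ t x)))
    (h0 : ∫ x, ρ t x * log (gg f ρ t x) = 0) (x) : gg f ρ t x = 1 := by
  have i1 : Integrable (fun x => ρ t x * log (gg f ρ t x) - ρ t x) := hi.sub (S.int t)
  have i2 : Integrable (fun x => ρ t x * log (gg f ρ t x) - ρ t x + exp (-f x)) := i1.add S.intν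
  have hz : ∫ x, (ρ t x * log (gg f ρ t x) - ρ t x + exp (-f x)) = 0 := by
    rw [integral_add i1 S.intν, integral_sub hi (S.int t), h0, S.prob, S.hν]; norm_num
  have hform : ∀ x, ρ t x * log (gg f ρ t x) - ρ t x + exp (-f x)
      = exp (-f x) * (gg f ρ t x * (log (gg f ρ t x) - 1) + 1) := by
    intro x
    rw [← S.eg t x]; ring
  have hstrict : ∀ g : ℝ, 0 < g → 0 ≤ g * (log g - 1) + 1 ∧ (g * (log g - 1) + 1 = 0 → g = 1) := by
    intro g hg
    have hinv : 0 < g⁻¹ := inv_pos.mpr hg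
    constructor
    · have := log_le_sub_one_of_pos hinv
      rw [log_inv] at this
      have := mul_le_mul_of_nonneg_left this hg.le
      have e : g * (g⁻¹ - 1) = 1 - g := by field_simp
      linarith
    · intro h
      by_contra hne
      have := log_lt_sub_one_of_pos hinv (fun h => hne (inv_eq_one.mp h))
      rw [log_inv] at this
      have := mul_lt_mul_of_pos_left this hg
      have e : g * (g⁻¹ - 1) = 1 - g := by field_simp
      linarith
  have hnn : ∀ x, 0 ≤ ρ t x * log (gg f ρ t x) - ρ t x + exp (-f x) := fun x => by
    rw [hform]; exact mul_nonneg (exp_pos _).le (hstrict _ (S.gpos t x)).1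
  have hae := (integral_eq_zero_iff_of_nonneg hnn i2).mp hz
  have hcont : Continuous (fun x => ρ t x * log (gg f ρ t x) - ρ t x + exp (-f x)) :=
    (((S.cx t).continuous.mul ((S.gcd t).continuous.log fun x => (S.gpos t x).ne')).sub
      (S.cx t).continuous).add (contDiff_expneg S.hf).continuous
  have heq := (Continuous.ae_eq_iff_eq volume hcont continuous_zero).mp hae
  have hx := congrFun heq x
  simp only [hform, Pi.zero_apply] at hx
  exact (hstrict _ (S.gpos t x)).2 ((mul_eq_zero.mp hx).resolve_left (exp_pos _).ne')

lemma FPSol.main (S : FPSol f ρ) (t : ℝ)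
    (hint1 : Integrable (fun x => ρ t x * log (gg f ρ t x)))
    (hint2 : Integrable (fun x => ρ t x * ‖gradient (fun y => log (gg f ρ t y)) x‖ ^ 2))
    (hderiv : HasDerivAt (fun s => ∫ x, ρ s x * log (gg f ρ s x))
      (∫ x, deriv (fun s => ρ s x) t * log (gg f ρ t x)) t)
    (hbdry : ∫ x, vdiv (fun y =>
        log (gg f ρ t y) • (exp (-f y) • gradient (gg f ρ t) y)) x = 0) :
    deriv (fun s => ∫ x, ρ s x * log (gg f ρ s x)) t
      = -∫ x, ρ t x * ‖gradient (fun y => log (gg f ρ t y)) x‖ ^ 2 := by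
  rw [hderiv.deriv]
  have hL : ContDiff ℝ 2 (fun y => log (gg f ρ t y)) := (S.gcd t).log fun x => (S.gpos t x).ne'
  have hgL : ∀ x, gradient (fun y => log (gg f ρ t y)) x
      = (gg f ρ t x)⁻¹ • gradient (gg f ρ t) x := fun x =>
    gradient_comp' (hasDerivAt_log (S.gpos t x).ne') ((S.gcd t).differentiable (by norm_num) x)
  have hpt : ∀ x, vdiv (fun y => log (gg f ρ t y) • (exp (-f y) • gradient (gg f ρ t) y)) x
      = deriv (fun s => ρ s x) t * log (gg f ρ t x)
        + ρ t x * ‖gradient (fun y => log (gg f ρ t y)) x‖ ^ 2 := by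
    intro x
    rw [vdiv_smul (hL.of_le (by norm_num)) (wfield S.hf (S.gcd t)), S.eqn', hgL, inner_smul_left,
      inner_smul_right, real_inner_self_eq_norm_sq, norm_smul, mul_pow, norm_eq_abs, sq_abs,
      ← S.eg t x]
    simp only [conj_trivial]
    have := (S.gpos t x).ne'
    unfold wlap
    field_simp
  simp_rw [hpt] at hbdry
  by_cases hI : Integrable (fun x => deriv (fun s => ρ s x) t * log (gg f ρ t x))
  · rw [integral_add hI hint2] at hbdry
    linarith
  · rw [integral_undef hI] at hderiv ⊢
    by_contra hne
    have hex : ∃ x₀, gradient (gg f ρ t) x₀ ≠ 0 := by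
      by_contra! hall
      apply hne
      simp [hgL, hall]
    obtain ⟨x₀, hx₀⟩ := hex
    have hH : ∫ x, ρ t x * log (gg f ρ t x) ≠ 0 := by
      intro h0
      have h1 : gg f ρ t = fun _ => 1 := funext (S.ent_zero hint1 h0)
      apply hx₀
      rw [h1]; exact gradient_const _ _
    obtain ⟨c, hc, δ, hδ, hdec⟩ := S.ent_decay hx₀ hint1
    have hev := hderiv.continuousAt.eventually_ne hH
    have hsl := (hasDerivAt_iff_tendsto_slope.mp hderiv).mono_left
      (nhdsWithin_mono t (show Ioi t ⊆ {t}ᶜ from fun y hy => ne_of_gt hy))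
    have e1 := hsl.eventually (lt_mem_nhds (show -c < 0 by linarith))
    have e2 : ∀ᶠ s in 𝓝[>] t, _ := hev.filter_mono nhdsWithin_le_nhds
    obtain ⟨s, ⟨hs1, hs2⟩, hs3⟩ := ((e1.and e2).and (Ioo_mem_nhdsGT (show t < t + δ by linarith))).exists
    have hsi : Integrable (fun x => ρ (t + (s - t)) x * log (gg f ρ (t + (s - t)) x)) := by
      rw [add_sub_cancel]
      by_contra h
      exact hs2 (integral_undef h)
    have := hdec (s - t) ⟨by linarith [hs3.1], by linarith [hs3.2]⟩ hsi
    rw [add_sub_cancel] at this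
    have hp : 0 < s - t := by linarith [hs3.1]
    rw [slope_def_field, lt_div_iff₀ hp] at hs1
    linarith

end fin

end helpers

theorem stmt5 {n : ℕ} (hn : 1 ≤ n) (f : EuclideanSpace ℝ (Fin n) → ℝ)
    (hf : ContDiff ℝ 2 f)
    (hν : ∫ x, exp (-f x) = 1)
    (ρ : ℝ → EuclideanSpace ℝ (Fin n) → ℝ)
    (hρpos : ∀ t x, 0 < ρ t x)
    (hρprob : ∀ t, ∫ x, ρ t x = 1)
    (hρx : ∀ t, ContDiff ℝ 2 (ρ t))
    (hρt : ∀ x, ContDiff ℝ 1 (fun s => ρ s x))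
    -- the Fokker–Planck equation ∂ρ/∂t = div (ρ ∇f + ∇ρ):
    (hFP : ∀ t x, deriv (fun s => ρ s x) t =
      vdiv (fun y => ρ t y • gradient f y + gradient (ρ t) y) x)
    (t : ℝ)
    -- (i) integrability:
    (hint1 : Integrable (fun x => ρ t x * log (ρ t x / exp (-f x))))
    (hint2 : Integrable (fun x => ρ t x * ‖gradient (fun y => log (ρ t y / exp (-f y))) x‖ ^ 2))
    -- (ii) differentiation under the integral sign:
    (hderiv : HasDerivAt (fun s => ∫ x, ρ s x * log (ρ s x / exp (-f x)))
      (∫ x, deriv (fun s => ρ s x) t * log (ρ t x / exp (-f x))) t)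
    -- (iii) the total divergence (the boundary term) vanishes:
    (hbdry : ∫ x, vdiv (fun y =>
        log (ρ t y / exp (-f y)) • (ρ t y • gradient f y + gradient (ρ t) y)) x = 0) :
    deriv (fun s => ∫ x, ρ s x * log (ρ s x / exp (-f x))) t
      = -∫ x, ρ t x * ‖gradient (fun y => log (ρ t y / exp (-f y))) x‖ ^ 2 := by
  have hFP2 : ∀ t, (fun y => ρ t y • gradient f y + gradient (ρ t) y)
      = fun y => exp (-f y) • gradient (gg f ρ t) y := fun t => funext fun y => flux_eq hf (hρx t) y
  have S : FPSol f ρ := ⟨hf, hν, hρpos, hρprob, hρx, hρt, fun t x => by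
    rw [hFP t x, hFP2 t]; rfl⟩
  have hq : ∀ s x, ρ s x / exp (-f x) = gg f ρ s x := fun s x => by
    unfold gg
    rw [exp_neg, div_inv_eq_mul]
  simp only [hq] at hint1 hint2 hderiv hbdry ⊢
  have hb : ∀ y, ρ t y • gradient f y + gradient (ρ t) y
      = exp (-f y) • gradient (gg f ρ t) y := fun y => flux_eq hf (hρx t) y
  simp only [hb] at hbdry
  exact S.main t hint1 hint2 hderiv hbdry
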